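/- arXiv:0705.0766 — 3 statements merged into one kernel-verified Lean document; each statement's English description precedes it below -/
import Mathlib

section
/- Let R be an algebraic curvature tensor on E with nonnegative isotropic curvature, and suppose the orthonormal four-frame {e_1,e_2,e_3,e_4} attains isotropic curvature zero. Then Σ_{p,q=1}^n (R_{1p1q} + R_{2p2q})(R_{3p3q} + R_{4p4q}) - Σ_{p,q=1}^n R_{12pq} R_{34pq} ≥ Σ_{p,q=1}^n (R_{1p3q} + R_{2p4q})(R_{3p1q} + R_{4p2q}) + Σ_{p,q=1}^n (R_{1p4q} - R_{2p3q})(R_{4p1q} - R_{3p2q}). -/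
open scoped BigOperators
open RealInnerProductSpace

noncomputable section

abbrev Euc (n : ℕ) : Type := EuclideanSpace ℝ (Fin n)

/-- The space of quadrilinear (multilinear) maps `E → E → E → E → ℝ`. -/
abbrev CurvMap (n : ℕ) : Type := Euc n →ₗ[ℝ] Euc n →ₗ[ℝ] Euc n →ₗ[ℝ] Euc n →ₗ[ℝ] ℝ

/-- `R` is an algebraic curvature tensor: antisymmetric in the first two arguments,
symmetric under interchange of the first and second pair, and satisfying the
first Bianchi identity. -/
def IsCurvatureTensor {n : ℕ} (R : CurvMap n) : Prop :=
  (∀ x y z w : Euc n, R x y z w = - R y x z w) ∧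
  (∀ x y z w : Euc n, R x y z w = R z w x y) ∧
  (∀ x y z w : Euc n, R x y z w + R y z x w + R z x y w = 0)

/-- Nonnegative isotropic curvature for a quadrilinear form on `EuclideanSpace ℝ (Fin m)`. -/
def NonnegIsotropic {m : ℕ} (R : Euc m → Euc m → Euc m → Euc m → ℝ) : Prop :=
  ∀ v₁ v₂ v₃ v₄ : Euc m, Orthonormal ℝ ![v₁, v₂, v₃, v₄] →
    0 ≤ R v₁ v₃ v₁ v₃ + R v₁ v₄ v₁ v₄ + R v₂ v₃ v₂ v₃ + R v₂ v₄ v₂ v₄ - 2 * R v₁ v₂ v₃ v₄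

section IsotropicCurvature

open Matrix ComplexConjugate ComplexOrder

/-- Quadrilinear forms on `ℂⁿ`. -/
abbrev ComplexTensor (n : ℕ) : Type :=
  (Fin n → ℂ) →ₗ[ℂ] (Fin n → ℂ) →ₗ[ℂ] (Fin n → ℂ) →ₗ[ℂ] (Fin n → ℂ) →ₗ[ℂ] ℂ

theorem nonneg_of_forall_pos_polynomial {a b c d e f g h : ℝ}
    (hp : ∀ s : ℝ, 0 < s → 0 ≤ a * s + b * s ^ 2 + c * s ^ 3 + d * s ^ 4 + e * s ^ 5 + f * s ^ 6
      + g * s ^ 7 + h * s ^ 8) : 0 ≤ a := by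
  have ht : Filter.Tendsto (fun s : ℝ => a + b * s + c * s ^ 2 + d * s ^ 3 + e * s ^ 4 + f * s ^ 5
      + g * s ^ 6 + h * s ^ 7) (nhdsWithin 0 (Set.Ioi 0)) (nhds a) := by
    have hc : Continuous (fun s : ℝ => a + b * s + c * s ^ 2 + d * s ^ 3 + e * s ^ 4 + f * s ^ 5
      + g * s ^ 6 + h * s ^ 7) := by fun_prop
    have := hc.tendsto 0
    simp at this
    exact this.mono_left nhdsWithin_le_nhds
  refine ge_of_tendsto ht ?_
  filter_upwards [self_mem_nhdsWithin] with s hs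
  have hs : 0 < s := hs
  have := hp s hs
  by_contra hneg
  push Not at hneg
  nlinarith [mul_neg_of_pos_of_neg hs hneg]

/-- Second-order conditions at a zero of a nonnegative real polynomial in `t` and `conj t`. -/
theorem hessian_nonneg_of_forall_nonneg {c : Fin 5 → Fin 5 → ℂ} (h₀ : c 0 0 = 0)
    (h : ∀ t : ℂ, 0 ≤ (∑ i : Fin 5, ∑ j : Fin 5, t ^ (i : ℕ) * conj t ^ (j : ℕ) * c i j).re) :
    0 ≤ (c 1 1).re ∧ c 1 0 + conj (c 0 1) = 0 := by
  let d : ℂ → ℕ → ℝ := fun θ m => ∑ i : Fin 5, ∑ j : Fin 5,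
    if (i : ℕ) + j = m then (θ ^ (i : ℕ) * conj θ ^ (j : ℕ) * c i j).re else 0
  have hd (θ : ℂ) (s : ℝ) : 0 ≤ ∑ m ∈ Finset.range 9, d θ m * s ^ m := by
    convert h (s * θ) using 1
    simp only [d, Finset.sum_mul, Complex.re_sum]
    rw [Finset.sum_comm]
    refine Finset.sum_congr rfl fun i _ => ?_
    rw [Finset.sum_comm]
    refine Finset.sum_congr rfl fun j _ => ?_
    simp only [ite_mul, zero_mul]
    rw [Finset.sum_ite_eq, if_pos (by simp; omega), mul_comm, ← Complex.re_ofReal_mul]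
    congr 1
    simp only [map_mul, Complex.conj_ofReal, mul_pow, Complex.ofReal_pow]
    ring
  have d0 (θ : ℂ) : d θ 0 = 0 := by simp [d, Fin.sum_univ_five, h₀]
  have d1 (θ : ℂ) : d θ 1 = (θ * c 1 0).re + (conj θ * c 0 1).re := by
    simp [d, Fin.sum_univ_five]; ring
  have d2 (θ : ℂ) : d θ 2 = (θ * conj θ * c 1 1).re + (θ ^ 2 * c 2 0).re
      + (conj θ ^ 2 * c 0 2).re := by
    simp only [d, Fin.sum_univ_five]
    norm_num
    ring
  have gradient (θ : ℂ) : 0 ≤ d θ 1 := by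
    refine nonneg_of_forall_pos_polynomial (b := d θ 2) (c := d θ 3) (d := d θ 4) (e := d θ 5)
      (f := d θ 6) (g := d θ 7) (h := d θ 8) fun s _ => ?_
    simpa [Finset.sum_range_succ, d0] using hd θ s
  have gradient_eq (θ : ℂ) : d θ 1 = 0 := by
    have h1 := gradient θ
    have h2 := gradient (-θ)
    simp only [d1, map_neg, neg_mul, Complex.neg_re] at h1 h2 ⊢
    linarith
  have hessian (θ : ℂ) : 0 ≤ d θ 2 := by
    refine nonneg_of_forall_pos_polynomial (b := d θ 3) (c := d θ 4) (d := d θ 5) (e := d θ 6)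
      (f := d θ 7) (g := d θ 8) (h := 0) fun s hs => ?_
    have := hd θ s
    simp only [Finset.sum_range_succ, Finset.sum_range_zero, d0, gradient_eq] at this
    refine (mul_nonneg_iff_of_pos_left hs).mp ?_
    linarith
  constructor
  · have h1 := hessian 1
    have h2 := hessian Complex.I
    simp [d2] at h1 h2
    linarith
  · have h1 := gradient_eq 1
    have h2 := gradient_eq Complex.I
    simp [d1] at h1 h2
    apply Complex.ext <;> simp <;> linarith

/-- A consequence of the Schur product theorem for block matrices. -/
theorem sum_mul_sub_sum_mul_nonneg {m : Type*} [Fintype m] [DecidableEq m]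
    {A B C D : Matrix m m ℂ} (h : (fromBlocks A (-B) (-C) D).PosSemidef) :
    0 ≤ (∑ p, ∑ q, (A p q * D p q - B p q * C p q)).re := by
  have h' := (h.hadamard (h.mul_mul_conjTranspose_same
    (fromBlocks 0 1 (-1) 0))).dotProduct_mulVec_nonneg 1
  rw [fromBlocks_conjTranspose, fromBlocks_multiply, fromBlocks_multiply] at h'
  simp [dotProduct, mulVec, Finset.sum_add_distrib] at h'
  have h'' := (Complex.nonneg_iff.mp h').1
  simp [Finset.sum_sub_distrib] at h'' ⊢
  simp only [mul_comm] at h'' ⊢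
  linarith

/-- The coefficients of the polynomial `φ (u₀ + t u₁ + t² u₂) (v₀ + t v₁ + t² v₂)` in `t`. -/
def curveCoeff {V M : Type*} [AddCommGroup V] [Module ℂ V] [AddCommGroup M] [Module ℂ M]
    (φ : V →ₗ[ℂ] V →ₗ[ℂ] M) (u₀ u₁ u₂ v₀ v₁ v₂ : V) : Fin 5 → M :=
  ![φ u₀ v₀, φ u₁ v₀ + φ u₀ v₁, φ u₁ v₁ + φ u₂ v₀ + φ u₀ v₂, φ u₂ v₁ + φ u₁ v₂, φ u₂ v₂]

theorem sum_curveCoeff {V M : Type*} [AddCommGroup V] [Module ℂ V] [AddCommGroup M] [Module ℂ M]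
    (φ : V →ₗ[ℂ] V →ₗ[ℂ] M) (u₀ u₁ u₂ v₀ v₁ v₂ : V) (t : ℂ) :
    φ (u₀ + t • u₁ + t ^ 2 • u₂) (v₀ + t • v₁ + t ^ 2 • v₂) =
      ∑ i : Fin 5, t ^ (i : ℕ) • curveCoeff φ u₀ u₁ u₂ v₀ v₁ v₂ i := by
  simp [Fin.sum_univ_five, curveCoeff]
  module

/-- The properties of the complex multilinear extension of an algebraic curvature tensor with
nonnegative isotropic curvature: nonnegativity holds on totally isotropic planes. -/
structure IsPIC {n : ℕ} (T : ComplexTensor n) : Prop where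
  antisymm : ∀ x y u v, T x y u v = - T y x u v
  pair_symm : ∀ x y u v, T x y u v = T u v x y
  conj_apply : ∀ x y u v, conj (T x y u v) = T (star x) (star y) (star u) (star v)
  nonneg : ∀ x y, x ⬝ᵥ x = 0 → y ⬝ᵥ y = 0 → x ⬝ᵥ y = 0 → 0 ≤ (T x y (star x) (star y)).re

theorem IsPIC.antisymm' {n : ℕ} {T : ComplexTensor n} (hT : IsPIC T) (x y u v : Fin n → ℂ) :
    T x y u v = - T x y v u := by
  rw [hT.pair_symm, hT.antisymm, hT.pair_symm]

theorem IsPIC.variation {n : ℕ} {T : ComplexTensor n} (hT : IsPIC T)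
    {z w x y p q : Fin n → ℂ} (h₀ : T z w (star z) (star w) = 0)
    (hz : ∀ t : ℂ, (z + t • x + t ^ 2 • p) ⬝ᵥ (z + t • x + t ^ 2 • p) = 0)
    (hw : ∀ t : ℂ, (w + t • y + t ^ 2 • q) ⬝ᵥ (w + t • y + t ^ 2 • q) = 0)
    (hzw : ∀ t : ℂ, (z + t • x + t ^ 2 • p) ⬝ᵥ (w + t • y + t ^ 2 • q) = 0) :
    0 ≤ (T x w (star x) (star w) + T z y (star z) (star y) + T x w (star z) (star y)
      + T z y (star x) (star w)).re ∧
    T x w (star z) (star w) + T z y (star z) (star w) = 0 := by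
  have h := hessian_nonneg_of_forall_nonneg
    (c := fun i j => curveCoeff (curveCoeff T z x p w y q i)
      (star z) (star x) (star p) (star w) (star y) (star q) j) (by simpa [curveCoeff] using h₀) ?_
  · simp only [curveCoeff] at h
    simp [hT.conj_apply] at h
    obtain ⟨h1, h2⟩ := h
    rw [hT.pair_symm (star z) (star w) x, hT.pair_symm (star z) (star w) z] at h2
    constructor
    · simp; linarith
    · linear_combination h2 / 2
  · intro t
    have := hT.nonneg _ _ (hz t) (hw t) (hzw t)
    rw [sum_curveCoeff] at this
    simp only [star_add, star_smul] at this
    simp only [LinearMap.sum_apply, LinearMap.smul_apply, star_pow] at this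
    simp only [sum_curveCoeff, smul_eq_mul, Finset.mul_sum, ← mul_assoc] at this
    exact this

/-- The vectors `z`, `w` span a totally isotropic plane and `z / √2`, `w / √2` are unitary. -/
structure IsIsotropicFrame {n : ℕ} (z w : Fin n → ℂ) : Prop where
  zz : z ⬝ᵥ z = 0
  ww : w ⬝ᵥ w = 0
  zw : z ⬝ᵥ w = 0
  zz' : z ⬝ᵥ star z = 2
  ww' : w ⬝ᵥ star w = 2
  zw' : z ⬝ᵥ star w = 0

/-- The vector `x` is orthogonal to the span of `z`, `w` and their conjugates. -/
structure IsTransverse {n : ℕ} (z w x : Fin n → ℂ) : Prop where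
  zx : z ⬝ᵥ x = 0
  wx : w ⬝ᵥ x = 0
  zx' : star z ⬝ᵥ x = 0
  wx' : star w ⬝ᵥ x = 0

theorem star_dotProduct_star_eq {n : ℕ} (x y : Fin n → ℂ) :
    star x ⬝ᵥ star y = conj (x ⬝ᵥ y) := by
  simp [dotProduct]

theorem IsPIC.variation_transverse {n : ℕ} {T : ComplexTensor n} (hT : IsPIC T)
    {z w x y : Fin n → ℂ} (hf : IsIsotropicFrame z w) (h₀ : T z w (star z) (star w) = 0)
    (hx : IsTransverse z w x) (hy : IsTransverse z w y) :
    0 ≤ (T x w (star x) (star w) + T z y (star z) (star y) + T x w (star z) (star y)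
      + T z y (star x) (star w)).re ∧
    T x w (star z) (star w) + T z y (star z) (star w) = 0 := by
  have hzz : star z ⬝ᵥ star z = 0 := by simp [star_dotProduct_star_eq, hf.zz]
  have hww : star w ⬝ᵥ star w = 0 := by simp [star_dotProduct_star_eq, hf.ww]
  have hzw : star z ⬝ᵥ star w = 0 := by simp [star_dotProduct_star_eq, hf.zw]
  have hzw' : star z ⬝ᵥ w = 0 := by
    simpa [← star_dotProduct_star_eq] using congrArg conj hf.zw'
  refine hT.variation (p := (-(x ⬝ᵥ x) / 4) • star z + (-(x ⬝ᵥ y) / 2) • star w)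
    (q := (-(y ⬝ᵥ y) / 4) • star w) h₀ (fun t => ?_) (fun t => ?_) (fun t => ?_) <;>
  · simp only [add_dotProduct, dotProduct_add, smul_dotProduct, dotProduct_smul, smul_eq_mul,
      dotProduct_comm x z, dotProduct_comm x w, dotProduct_comm x (star z),
      dotProduct_comm x (star w), dotProduct_comm y w,
      dotProduct_comm y (star w), dotProduct_comm (star z) z,
      dotProduct_comm (star w) w, dotProduct_comm (star w) z, dotProduct_comm (star w) (star z),
      hf.zz, hf.ww, hf.zw, hf.zz', hf.ww', hf.zw', hzz, hww, hzw, hzw', hx.zx, hx.wx, hx.zx', hx.wx',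
      hy.zx, hy.wx, hy.zx', hy.wx']
    ring

theorem IsTransverse.zero {n : ℕ} {z w : Fin n → ℂ} : IsTransverse z w 0 := by
  constructor <;> simp

theorem IsPIC.variation_rotation {n : ℕ} {T : ComplexTensor n} (hT : IsPIC T)
    {z w : Fin n → ℂ} (hf : IsIsotropicFrame z w) (h₀ : T z w (star z) (star w) = 0) :
    T (star w) w (star z) (star w) = T z (star z) (star z) (star w) := by
  have hzz : star z ⬝ᵥ star z = 0 := by simp [star_dotProduct_star_eq, hf.zz]
  have hww : star w ⬝ᵥ star w = 0 := by simp [star_dotProduct_star_eq, hf.ww]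
  have hzw : star z ⬝ᵥ star w = 0 := by simp [star_dotProduct_star_eq, hf.zw]
  have hzw' : star z ⬝ᵥ w = 0 := by
    simpa [← star_dotProduct_star_eq] using congrArg conj hf.zw'
  have := (hT.variation (x := star w) (y := -star z) (p := 0) (q := 0) h₀
    (fun t => ?_) (fun t => ?_) (fun t => ?_)).2
  · simpa [← sub_eq_add_neg, sub_eq_zero] using this
  all_goals
    simp only [add_dotProduct, dotProduct_add, smul_dotProduct, dotProduct_smul, smul_eq_mul,
      smul_zero, dotProduct_zero, neg_dotProduct, dotProduct_neg,
      zero_dotProduct,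
      dotProduct_comm (star w) w, dotProduct_comm (star w) z, dotProduct_comm (star w) (star z),
      dotProduct_comm w (star z),
      hf.zz, hf.ww, hf.zw, hf.zz', hf.ww', hf.zw', hzz, hww, hzw, hzw']
    ring

theorem IsPIC.transverse_sum_nonneg {n : ℕ} {ι : Type*} [Fintype ι] [DecidableEq ι]
    {T : ComplexTensor n} (hT : IsPIC T)
    {z w : Fin n → ℂ} (hf : IsIsotropicFrame z w) (h₀ : T z w (star z) (star w) = 0)
    {f : ι → Fin n → ℂ} (hf' : ∀ i, IsTransverse z w (f i)) (hreal : ∀ i, star (f i) = f i) :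
    0 ≤ (∑ p, ∑ q, (T z (f p) (star z) (f q) * T w (f p) (star w) (f q)
      - T z (f p) (star w) (f q) * T w (f p) (star z) (f q))).re := by
  let A : Matrix ι ι ℂ := of fun p q => T z (f q) (star z) (f p)
  let B : Matrix ι ι ℂ := of fun p q => T z (f q) (star w) (f p)
  let C : Matrix ι ι ℂ := of fun p q => T w (f q) (star z) (f p)
  let D : Matrix ι ι ℂ := of fun p q => T w (f q) (star w) (f p)
  have hpsd : (fromBlocks D (-B) (-C) A).PosSemidef := by
    have herm : (fromBlocks D (-B) (-C) A).IsHermitian := by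
      refine IsHermitian.fromBlocks ?_ ?_ ?_ <;> ext i j <;>
        simp [A, B, C, D, hT.conj_apply, hreal]
      · exact hT.pair_symm _ _ _ _
      · exact hT.pair_symm _ _ _ _
      · exact hT.pair_symm _ _ _ _
    refine .of_dotProduct_mulVec_nonneg herm fun v => ?_
    rw [Complex.nonneg_iff]
    refine ⟨?_, (herm.im_star_dotProduct_mulVec_self v).symm⟩
    have htr (g : ι → ℂ) : IsTransverse z w (∑ i, g i • f i) := by
      constructor <;> simp [dotProduct_sum, (hf' _).zx, (hf' _).wx, (hf' _).zx', (hf' _).wx']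
    have := (hT.variation_transverse hf h₀ (htr (v ∘ Sum.inl)) (htr (v ∘ Sum.inr))).1
    convert this using 2
    simp [dotProduct, mulVec, A, B, C, D, hreal, hT.antisymm _ w,
      Finset.mul_sum, mul_add, Finset.sum_add_distrib]
    simp only [hT.antisymm' _ _ _ (star w), mul_neg, Finset.sum_neg_distrib, neg_neg]
    simp only [mul_comm, mul_left_comm]
    ring
  have := sum_mul_sub_sum_mul_nonneg hpsd
  simp only [A, B, C, D, of_apply] at this
  rw [Finset.sum_comm] at this
  simpa only [mul_comm] using this

/-- The null vector `e_i + I e_j`. -/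
def nullVec {n : ℕ} (i j : Fin n) : Fin n → ℂ := Pi.single i 1 + Complex.I • Pi.single j 1

theorem star_nullVec {n : ℕ} (i j : Fin n) :
    star (nullVec i j) = Pi.single i 1 - Complex.I • Pi.single j 1 := by
  simp [nullVec, sub_eq_add_neg]

theorem apply_mul_apply_add {V : Type*} [AddCommGroup V] [Module ℂ V] (φ ψ : V →ₗ[ℂ] ℂ) (x y : V) :
    φ x * ψ x + φ y * ψ y = (φ (x + Complex.I • y) * ψ (x - Complex.I • y)
      + φ (x - Complex.I • y) * ψ (x + Complex.I • y)) / 2 := by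
  simp only [map_add, map_sub, map_smul, smul_eq_mul]
  linear_combination φ y * ψ y * Complex.I_sq

theorem sum_apply_mul_apply {m : ℕ} (φ ψ : (Fin (4 + m) → ℂ) →ₗ[ℂ] ℂ) {z w : Fin (4 + m) → ℂ}
    (hz : z = nullVec (Fin.castAdd m 0) (Fin.castAdd m 1))
    (hw : w = nullVec (Fin.castAdd m 2) (Fin.castAdd m 3)) :
    ∑ p, φ (Pi.single p 1) * ψ (Pi.single p 1) =
      (φ z * ψ (star z) + φ (star z) * ψ z + φ w * ψ (star w) + φ (star w) * ψ w) / 2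
      + ∑ i : Fin m, φ (Pi.single (Fin.natAdd 4 i) 1) * ψ (Pi.single (Fin.natAdd 4 i) 1) := by
  rw [Fin.sum_univ_add, Fin.sum_univ_four, add_assoc (_ * _ + _ * _), apply_mul_apply_add,
    apply_mul_apply_add, hz, hw, star_nullVec, star_nullVec, nullVec, nullVec]
  ring

theorem isIsotropicFrame_nullVec {m : ℕ} :
    IsIsotropicFrame (nullVec (Fin.castAdd m (0 : Fin 4)) (Fin.castAdd m 1))
      (nullVec (Fin.castAdd m 2) (Fin.castAdd m 3)) := by
  constructor <;> rw [nullVec] <;> try rw [star_nullVec]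
  all_goals
    simp [nullVec]
  all_goals norm_num

theorem isTransverse_nullVec {m : ℕ} (i : Fin m) :
    IsTransverse (nullVec (Fin.castAdd m (0 : Fin 4)) (Fin.castAdd m 1))
      (nullVec (Fin.castAdd m 2) (Fin.castAdd m 3)) (Pi.single (Fin.natAdd 4 i) 1) := by
  have h (j : Fin 4) : Fin.castAdd m j ≠ Fin.natAdd 4 i := by
    simp [Fin.ext_iff]; omega
  constructor <;> simp [nullVec, (h _).symm]

theorem IsPIC.sum_nonneg {m : ℕ} {T : ComplexTensor (4 + m)} (hT : IsPIC T)
    {z w : Fin (4 + m) → ℂ}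
    (hz : z = nullVec (Fin.castAdd m 0) (Fin.castAdd m 1))
    (hw : w = nullVec (Fin.castAdd m 2) (Fin.castAdd m 3))
    (h₀ : T z w (star z) (star w) = 0) :
    0 ≤ (∑ p, ∑ q,
      (T z (Pi.single p 1) (star z) (Pi.single q 1) * T w (Pi.single p 1) (star w) (Pi.single q 1)
      - T z (Pi.single p 1) (star w) (Pi.single q 1)
        * T w (Pi.single p 1) (star z) (Pi.single q 1))).re := by
  have hf : IsIsotropicFrame z w := by rw [hz, hw]; exact isIsotropicFrame_nullVec
  set f : Fin m → Fin (4 + m) → ℂ := fun i => Pi.single (Fin.natAdd 4 i) 1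
  have hf' (i : Fin m) : IsTransverse z w (f i) := by rw [hz, hw]; exact isTransverse_nullVec i
  have hreal (i : Fin m) : star (f i) = f i := by simp [f]
  have diag (x u v) : T x x u v = 0 := by
    have := hT.antisymm x x u v
    linear_combination this / 2
  have diag' (x u v) : T u v x x = 0 := by rw [hT.pair_symm, diag]
  have outer (a b c d : Fin (4 + m) → ℂ) :
      ∑ p, T z (Pi.single p 1) a b * T w (Pi.single p 1) c d =
      (T z (star z) a b * T w z c d + T z w a b * T w (star w) c d) / 2
        + ∑ i, T z (f i) a b * T w (f i) c d := by
    have := sum_apply_mul_apply (((T z).flip a).flip b) (((T w).flip c).flip d) hz hw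
    simpa only [LinearMap.flip_apply, diag, zero_mul, mul_zero, add_zero, zero_add] using this
  have split (φ ψ : (Fin (4 + m) → ℂ) →ₗ[ℂ] ℂ) : ∑ p, φ (Pi.single p 1) * ψ (Pi.single p 1) =
      (φ z * ψ (star z) + φ (star z) * ψ z + φ w * ψ (star w) + φ (star w) * ψ w) / 2
      + ∑ i, φ (f i) * ψ (f i) := sum_apply_mul_apply φ ψ hz hw
  have n1 (i) : T (f i) w (star z) (star w) = 0 := by
    simpa using (hT.variation_transverse hf h₀ (hf' i) .zero).2
  have n2 (i) : T z (f i) (star z) (star w) = 0 := by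
    simpa using (hT.variation_transverse hf h₀ .zero (hf' i)).2
  have n3 (i) : T z w (f i) (star w) = 0 := by
    have := congrArg conj (n1 i)
    rwa [hT.conj_apply, hT.pair_symm, map_zero, star_star, star_star, hreal] at this
  have n4 (i) : T z w (star z) (f i) = 0 := by
    have := congrArg conj (n2 i)
    rwa [hT.conj_apply, hT.pair_symm, map_zero, star_star, star_star, hreal] at this
  have n5 (i) : T w (f i) (star z) (star w) = 0 := by rw [hT.antisymm, n1, neg_zero]
  have n6 (i) : T w (f i) (star w) (star z) = 0 := by rw [hT.antisymm', n5, neg_zero]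
  have n7 (i) : T z (f i) (star w) (star z) = 0 := by rw [hT.antisymm', n2, neg_zero]
  have n8 (i) : T z w (star w) (f i) = 0 := by rw [hT.antisymm', n3, neg_zero]
  have n9 (i) : T w z (star w) (f i) = 0 := by rw [hT.antisymm, n8, neg_zero]
  have n10 (i) : T w z (star z) (f i) = 0 := by rw [hT.antisymm, n4, neg_zero]
  have n11 : T w z (star z) (star w) = 0 := by rw [hT.antisymm, h₀, neg_zero]
  have n12 : T z w (star w) (star z) = 0 := by rw [hT.antisymm', h₀, neg_zero]
  have n13 : T w z (star w) (star z) = 0 := by rw [hT.antisymm', n11, neg_zero]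
  have rot := hT.variation_rotation hf h₀
  obtain ⟨α, hα⟩ : ∃ α, T z (star z) (star z) (star w) = α := ⟨_, rfl⟩
  have r1 : T w (star w) (star z) (star w) = -α := by rw [hT.antisymm, rot, hα]
  have r2 : T w (star w) (star w) (star z) = α := by rw [hT.antisymm', r1, neg_neg]
  have r3 : T z (star z) (star w) (star z) = -α := by rw [hT.antisymm', hα]
  have r4 : T z w (star z) z = conj α := by
    rw [← hα, hT.conj_apply, hT.pair_symm, star_star, star_star]
  have r5 : T w z (star z) z = -conj α := by rw [hT.antisymm, r4]
  have r6 : T z w (star w) w = -conj α := by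
    rw [← hα, ← rot, hT.conj_apply, hT.pair_symm, star_star, star_star, hT.antisymm]
  have r7 : T w z (star w) w = conj α := by rw [hT.antisymm, r6, neg_neg]
  have e1 : ∑ p, ∑ q, T z (Pi.single p 1) (star z) (Pi.single q 1)
        * T w (Pi.single p 1) (star w) (Pi.single q 1)
      = α * conj α / 2
        + ∑ p, ∑ q, T z (f p) (star z) (f q) * T w (f p) (star w) (f q) := by
    simp only [split, diag', zero_mul, mul_zero, add_zero]
    rw [Finset.sum_add_distrib, ← Finset.sum_div, Finset.sum_add_distrib, Finset.sum_comm]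
    simp only [outer, hα, h₀, n6, n2, n4, n9, n13, r2, r4, r7, zero_mul, mul_zero, add_zero,
      zero_add, zero_div, Finset.sum_const_zero]
    rw [Finset.sum_comm]
    ring
  have e2 : ∑ p, ∑ q, T z (Pi.single p 1) (star w) (Pi.single q 1)
        * T w (Pi.single p 1) (star z) (Pi.single q 1)
      = α * conj α / 2
        + ∑ p, ∑ q, T z (f p) (star w) (f q) * T w (f p) (star z) (f q) := by
    simp only [split, diag', zero_mul, mul_zero, add_zero, zero_add]
    rw [Finset.sum_add_distrib, ← Finset.sum_div, Finset.sum_add_distrib, Finset.sum_comm]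
    simp only [outer, n5, n7, n8, n10, n11, n12, r1, r3, r5, r6, zero_mul, mul_zero, add_zero,
      zero_add, zero_div, Finset.sum_const_zero]
    rw [Finset.sum_comm]
    ring
  have := hT.transverse_sum_nonneg hf h₀ hf' hreal
  simp only [Finset.sum_sub_distrib] at this ⊢
  rw [e1, e2]
  convert this using 2
  ring

/-- The complex multilinear extension of `R`, in coordinates with respect to `b`. -/
def complexify {n : ℕ} (R : CurvMap n) (b : OrthonormalBasis (Fin n) ℝ (Euc n)) :
    ComplexTensor n :=
  ∑ i, ∑ j, ∑ k, ∑ l, (R (b i) (b j) (b k) (b l) : ℂ) •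
    (LinearMap.proj i).smulRight ((LinearMap.proj j).smulRight
      ((LinearMap.proj k).smulRight (LinearMap.proj l)))

variable {n : ℕ} {R : CurvMap n} {b : OrthonormalBasis (Fin n) ℝ (Euc n)}

theorem complexify_apply (x y u v : Fin n → ℂ) :
    complexify R b x y u v =
      ∑ i, ∑ j, ∑ k, ∑ l, (R (b i) (b j) (b k) (b l) : ℂ) * (x i * (y j * (u k * v l))) := by
  simp only [complexify, LinearMap.sum_apply, LinearMap.smul_apply, LinearMap.smulRight_apply,
    LinearMap.proj_apply, smul_eq_mul]

theorem complexify_apply_ofReal (x y u v : Fin n → ℝ) :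
    complexify R b (fun i => (x i : ℂ)) (fun i => (y i : ℂ)) (fun i => (u i : ℂ))
      (fun i => (v i : ℂ)) =
      (R (∑ i, x i • b i) (∑ i, y i • b i) (∑ i, u i • b i) (∑ i, v i • b i) : ℂ) := by
  rw [complexify_apply]
  have h1 (Y U V : Euc n) : R (∑ i, x i • b i) Y U V = ∑ i, x i * R (b i) Y U V := by
    simp [LinearMap.sum_apply]
  have h2 (X U V : Euc n) : R X (∑ i, y i • b i) U V = ∑ i, y i * R X (b i) U V := by
    simp [LinearMap.sum_apply]
  have h3 (X Y V : Euc n) : R X Y (∑ i, u i • b i) V = ∑ i, u i * R X Y (b i) V := by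
    simp [LinearMap.sum_apply]
  have h4 (X Y U : Euc n) : R X Y U (∑ i, v i • b i) = ∑ i, v i * R X Y U (b i) := by
    simp
  simp only [h1, h2, h3, h4, Finset.mul_sum, Complex.ofReal_sum, Complex.ofReal_mul]
  refine Finset.sum_congr rfl fun i _ => Finset.sum_congr rfl fun j _ =>
    Finset.sum_congr rfl fun k _ => Finset.sum_congr rfl fun l _ => ?_
  ring

theorem complexify_apply_single (i j k l : Fin n) :
    complexify R b (Pi.single i 1) (Pi.single j 1) (Pi.single k 1) (Pi.single l 1) =
      (R (b i) (b j) (b k) (b l) : ℂ) := by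
  simp [complexify_apply, Pi.single_apply]

theorem complexify_antisymm (hR : IsCurvatureTensor R) (x y u v : Fin n → ℂ) :
    complexify R b x y u v = - complexify R b y x u v := by
  simp only [complexify_apply, ← Finset.sum_neg_distrib]
  rw [Finset.sum_comm]
  refine Finset.sum_congr rfl fun i _ => Finset.sum_congr rfl fun j _ =>
    Finset.sum_congr rfl fun k _ => Finset.sum_congr rfl fun l _ => ?_
  rw [hR.1 (b j)]
  push_cast
  ring

theorem complexify_pair_symm (hR : IsCurvatureTensor R) (x y u v : Fin n → ℂ) :
    complexify R b x y u v = complexify R b u v x y := by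
  have h (f : Fin n → Fin n → Fin n → Fin n → ℂ) :
      ∑ i, ∑ j, ∑ k, ∑ l, f i j k l = ∑ k, ∑ l, ∑ i, ∑ j, f i j k l := by
    have := Finset.sum_comm (s := Finset.univ) (t := Finset.univ)
      (f := fun (p q : Fin n × Fin n) => f p.1 p.2 q.1 q.2)
    simpa only [Fintype.sum_prod_type] using this
  rw [complexify_apply, complexify_apply, h]
  refine Finset.sum_congr rfl fun i _ => Finset.sum_congr rfl fun j _ =>
    Finset.sum_congr rfl fun k _ => Finset.sum_congr rfl fun l _ => ?_
  rw [hR.2.1 (b k)]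
  ring

theorem conj_complexify_apply (x y u v : Fin n → ℂ) :
    conj (complexify R b x y u v) = complexify R b (star x) (star y) (star u) (star v) := by
  simp [complexify_apply]

theorem isotropic_of_orthogonal
    (hnic : NonnegIsotropic (fun x y z w => R x y z w)) {v₁ v₂ v₃ v₄ : Euc n} {r s : ℝ}
    (h12 : inner ℝ v₁ v₂ = 0) (h13 : inner ℝ v₁ v₃ = 0) (h14 : inner ℝ v₁ v₄ = 0)
    (h23 : inner ℝ v₂ v₃ = 0) (h24 : inner ℝ v₂ v₄ = 0) (h34 : inner ℝ v₃ v₄ = 0) (h1 : ‖v₁‖ = r) (h2 : ‖v₂‖ = r)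
    (h3 : ‖v₃‖ = s) (h4 : ‖v₄‖ = s) :
    0 ≤ R v₁ v₃ v₁ v₃ + R v₁ v₄ v₁ v₄ + R v₂ v₃ v₂ v₃ + R v₂ v₄ v₂ v₄ - 2 * R v₁ v₂ v₃ v₄ := by
  rcases eq_or_ne r 0 with rfl | hr
  · simp [norm_eq_zero.mp h1, norm_eq_zero.mp h2]
  rcases eq_or_ne s 0 with rfl | hs
  · simp [norm_eq_zero.mp h3, norm_eq_zero.mp h4]
  have hr0 : 0 ≤ r := h1 ▸ norm_nonneg _
  have hs0 : 0 ≤ s := h3 ▸ norm_nonneg _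
  have horth : Orthonormal ℝ ![r⁻¹ • v₁, r⁻¹ • v₂, s⁻¹ • v₃, s⁻¹ • v₄] := by
    constructor
    · intro i
      fin_cases i <;> simp [norm_smul, h1, h2, h3, h4, hr, hs, abs_of_nonneg, hr0, hs0]
    · intro i j hij
      fin_cases i <;> fin_cases j <;>
        first
        | exact absurd rfl hij
        | simp [inner_smul_left, inner_smul_right, h12, h13, h14, h23, h24, h34,
            real_inner_comm v₁, real_inner_comm v₂, real_inner_comm v₃]
  have := hnic _ _ _ _ horth
  simp only [map_smul, LinearMap.smul_apply, smul_eq_mul] at this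
  have h := mul_nonneg this (by positivity : 0 ≤ r ^ 2 * s ^ 2)
  have e : (r⁻¹ * s⁻¹) ^ 2 * (r ^ 2 * s ^ 2) = 1 := by field_simp
  refine h.trans_eq ?_
  linear_combination e * (R v₁ v₃ v₁ v₃ + R v₁ v₄ v₁ v₄ + R v₂ v₃ v₂ v₃ + R v₂ v₄ v₂ v₄
    - 2 * R v₁ v₂ v₃ v₄)

theorem complexify_nonneg_of_unitary (hR : IsCurvatureTensor R)
    (hnic : NonnegIsotropic (fun x y z w => R x y z w)) {x y : Fin n → ℂ}
    (hx : x ⬝ᵥ x = 0) (hy : y ⬝ᵥ y = 0) (hxy : x ⬝ᵥ y = 0) (hxy' : star x ⬝ᵥ y = 0) :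
    0 ≤ (complexify R b x y (star x) (star y)).re := by
  set a : Euc n := ∑ i, (x i).re • b i with ha
  set a' : Euc n := ∑ i, (x i).im • b i with ha'
  set c : Euc n := ∑ i, (y i).re • b i with hc
  set c' : Euc n := ∑ i, (y i).im • b i with hc'
  have hinner (f g : Fin n → ℝ) :
      inner ℝ (∑ i, f i • b i) (∑ i, g i • b i) = ∑ i, f i * g i := by
    rw [b.orthonormal.inner_sum]
    simp
  have x1 := congrArg Complex.re hx
  have x2 := congrArg Complex.im hx
  have y1 := congrArg Complex.re hy
  have y2 := congrArg Complex.im hy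
  have xy1 := congrArg Complex.re hxy
  have xy2 := congrArg Complex.im hxy
  have xy3 := congrArg Complex.re hxy'
  have xy4 := congrArg Complex.im hxy'
  simp [dotProduct, Finset.sum_add_distrib, ← hinner, ← ha, ← ha', ← hc, ← hc']
    at x1 x2 y1 y2 xy1 xy2 xy3 xy4
  have key := isotropic_of_orthogonal hnic (v₁ := a) (v₂ := a') (v₃ := c) (v₄ := c')
    (r := ‖a‖) (s := ‖c‖)
    (by linarith [real_inner_comm a a']) (by linarith) (by linarith) (by linarith) (by linarith)
    (by linarith [real_inner_comm c c']) rfl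
    ?_ rfl ?_
  · have hxe : x = (fun i => ((x i).re : ℂ)) + Complex.I • (fun i => ((x i).im : ℂ)) := by
      ext i; simp [mul_comm Complex.I, Complex.re_add_im]
    have hye : y = (fun i => ((y i).re : ℂ)) + Complex.I • (fun i => ((y i).im : ℂ)) := by
      ext i; simp [mul_comm Complex.I, Complex.re_add_im]
    have hxs : star x = (fun i => ((x i).re : ℂ)) - Complex.I • (fun i => ((x i).im : ℂ)) := by
      ext i; apply Complex.ext <;> simp
    have hys : star y = (fun i => ((y i).re : ℂ)) - Complex.I • (fun i => ((y i).im : ℂ)) := by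
      ext i; apply Complex.ext <;> simp
    rw [hxs, hys]
    nth_rewrite 1 [hxe]
    nth_rewrite 1 [hye]
    simp only [map_add, map_sub, map_smul, LinearMap.add_apply, LinearMap.sub_apply,
      LinearMap.smul_apply, complexify_apply_ofReal, smul_eq_mul, ← ha, ← ha', ← hc, ← hc']
    simp only [Complex.add_re, Complex.sub_re, Complex.mul_re, Complex.add_im, Complex.sub_im,
      Complex.mul_im, Complex.I_re, Complex.I_im, Complex.ofReal_re, Complex.ofReal_im]
    linarith [hR.2.1 a' c' a c, hR.2.1 a c' a' c, hR.2.2 a a' c c', hR.1 c a a' c']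
  · exact (sq_eq_sq₀ (norm_nonneg _) (norm_nonneg _)).mp (by linarith)
  · exact (sq_eq_sq₀ (norm_nonneg _) (norm_nonneg _)).mp (by linarith)

theorem isPIC_complexify (hR : IsCurvatureTensor R)
    (hnic : NonnegIsotropic (fun x y z w => R x y z w)) : IsPIC (complexify R b) where
  antisymm := complexify_antisymm hR
  pair_symm := complexify_pair_symm hR
  conj_apply := conj_complexify_apply
  nonneg x y hx hy hxy := by
    rcases eq_or_ne x 0 with rfl | hx0
    · simp
    have hne : star x ⬝ᵥ x ≠ 0 := by simpa using hx0
    set c := (star x ⬝ᵥ y) / (star x ⬝ᵥ x)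
    have := complexify_nonneg_of_unitary (b := b) hR hnic (x := x) (y := y - c • x) hx
      (by simp [hx, hy, hxy, dotProduct_comm y x]) (by simp [hx, hxy]) (by simp [c, hne])
    have d1 (x u v) : complexify R b x x u v = 0 := by
      have := complexify_antisymm (b := b) hR x x u v
      linear_combination this / 2
    have d2 (x u v) : complexify R b u v x x = 0 := by rw [complexify_pair_symm hR, d1]
    simpa [d1, d2] using this

theorem complexify_nullVec_single (i j k l p q : Fin n) :
    complexify R b (nullVec i j) (Pi.single p 1) (star (nullVec k l)) (Pi.single q 1) =
      ((R (b i) (b p) (b k) (b q) + R (b j) (b p) (b l) (b q) : ℝ) : ℂ) +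
        ((R (b j) (b p) (b k) (b q) - R (b i) (b p) (b l) (b q) : ℝ) : ℂ) * Complex.I := by
  rw [star_nullVec, nullVec]
  simp only [map_add, map_sub, map_smul, LinearMap.add_apply,
    LinearMap.sub_apply, LinearMap.smul_apply, complexify_apply_single, smul_eq_mul]
  push_cast
  linear_combination -(R (b j) (b p) (b l) (b q) : ℂ) * Complex.I_sq

theorem complexify_nullVec_eq_zero (hR : IsCurvatureTensor R) {i j k l : Fin n}
    (h : R (b i) (b k) (b i) (b k) + R (b i) (b l) (b i) (b l) + R (b j) (b k) (b j) (b k)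
      + R (b j) (b l) (b j) (b l) - 2 * R (b i) (b j) (b k) (b l) = 0) :
    complexify R b (nullVec i j) (nullVec k l) (star (nullVec i j)) (star (nullVec k l)) = 0 := by
  simp only [star_nullVec]
  simp only [nullVec, map_add, map_sub, map_smul, LinearMap.add_apply,
    LinearMap.sub_apply, LinearMap.smul_apply, complexify_apply_single, smul_eq_mul]
  apply Complex.ext <;>
    simp only [Complex.add_re, Complex.sub_re, Complex.mul_re, Complex.add_im, Complex.sub_im,
      Complex.mul_im, Complex.I_re, Complex.I_im, Complex.ofReal_re, Complex.ofReal_im,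
      Complex.zero_re, Complex.zero_im]
  · linarith [hR.2.1 (b j) (b l) (b i) (b k), hR.2.1 (b i) (b l) (b j) (b k),
      hR.2.2 (b i) (b j) (b k) (b l), hR.1 (b k) (b i) (b j) (b l)]
  · linarith [hR.2.1 (b i) (b k) (b i) (b l), hR.2.1 (b i) (b k) (b j) (b k),
      hR.2.1 (b j) (b k) (b j) (b l), hR.2.1 (b i) (b l) (b j) (b l)]

theorem re_complexify_nullVec_single (hR : IsCurvatureTensor R) (i j k l p q : Fin n) :
    (complexify R b (nullVec i j) (Pi.single p 1) (star (nullVec i j)) (Pi.single q 1) *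
        complexify R b (nullVec k l) (Pi.single p 1) (star (nullVec k l)) (Pi.single q 1) -
      complexify R b (nullVec i j) (Pi.single p 1) (star (nullVec k l)) (Pi.single q 1) *
        complexify R b (nullVec k l) (Pi.single p 1) (star (nullVec i j)) (Pi.single q 1)).re =
      (R (b i) (b p) (b i) (b q) + R (b j) (b p) (b j) (b q)) *
          (R (b k) (b p) (b k) (b q) + R (b l) (b p) (b l) (b q))
        - R (b i) (b j) (b p) (b q) * R (b k) (b l) (b p) (b q)
        - ((R (b i) (b p) (b k) (b q) + R (b j) (b p) (b l) (b q)) *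
            (R (b k) (b p) (b i) (b q) + R (b l) (b p) (b j) (b q))
          + (R (b i) (b p) (b l) (b q) - R (b j) (b p) (b k) (b q)) *
            (R (b l) (b p) (b i) (b q) - R (b k) (b p) (b j) (b q))) := by
  have bianchi (i j : Fin n) :
      R (b j) (b p) (b i) (b q) - R (b i) (b p) (b j) (b q) = - R (b i) (b j) (b p) (b q) := by
    linarith [hR.2.2 (b i) (b j) (b p) (b q), hR.1 (b p) (b i) (b j) (b q)]
  simp only [complexify_nullVec_single, bianchi]
  simp only [Complex.add_re, Complex.sub_re, Complex.mul_re, Complex.add_im,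
    Complex.mul_im, Complex.I_re, Complex.I_im, Complex.ofReal_re, Complex.ofReal_im]
  ring

end IsotropicCurvature

/-- Corollary `pic.is.preserved.1` (first part): the key inequality for the full sums over
`p, q = 1, …, n`, at a frame where the isotropic curvature attains its minimum value zero. -/
theorem stmt_0 {n : ℕ} (hn : 4 ≤ n) (R : CurvMap n) (hR : IsCurvatureTensor R)
    (b : OrthonormalBasis (Fin n) ℝ (Euc n))
    (hnic : NonnegIsotropic (fun x y z w => R x y z w)) :
    let e₁ : Euc n := b ⟨0, by omega⟩
    let e₂ : Euc n := b ⟨1, by omega⟩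
    let e₃ : Euc n := b ⟨2, by omega⟩
    let e₄ : Euc n := b ⟨3, by omega⟩
    R e₁ e₃ e₁ e₃ + R e₁ e₄ e₁ e₄ + R e₂ e₃ e₂ e₃ + R e₂ e₄ e₂ e₄ - 2 * R e₁ e₂ e₃ e₄ = 0 →
    (∑ p : Fin n, ∑ q : Fin n,
        (R e₁ (b p) e₁ (b q) + R e₂ (b p) e₂ (b q)) *
          (R e₃ (b p) e₃ (b q) + R e₄ (b p) e₄ (b q)))
      - (∑ p : Fin n, ∑ q : Fin n, R e₁ e₂ (b p) (b q) * R e₃ e₄ (b p) (b q))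
    ≥ (∑ p : Fin n, ∑ q : Fin n,
        (R e₁ (b p) e₃ (b q) + R e₂ (b p) e₄ (b q)) *
          (R e₃ (b p) e₁ (b q) + R e₄ (b p) e₂ (b q)))
      + (∑ p : Fin n, ∑ q : Fin n,
        (R e₁ (b p) e₄ (b q) - R e₂ (b p) e₃ (b q)) *
          (R e₄ (b p) e₁ (b q) - R e₃ (b p) e₂ (b q))) := by
  intro e₁ e₂ e₃ e₄ h
  obtain ⟨m, rfl⟩ := Nat.exists_eq_add_of_le hn
  have key := (isPIC_complexify (b := b) hR hnic).sum_nonneg rfl rfl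
    (complexify_nullVec_eq_zero hR h)
  simp only [Complex.re_sum, re_complexify_nullVec_single hR] at key
  simp only [Finset.sum_sub_distrib, Finset.sum_add_distrib] at key
  exact sub_nonneg.mp key
end
end

section
/- Nonnegative isotropic curvature is preserved by the Hamilton ODE: if R(t), t ∈ [0,T), is a solution of the ODE dR/dt = Q(R) in the space of algebraic curvature tensors on E, and R(0) has nonnegative isotropic curvature, then R(t) has nonnegative isotropic curvature for all t ∈ [0,T). -/
open scoped BigOperators

noncomputable section

/-- The finite-dimensional normed space of quadrilinear forms on `EuclideanSpace ℝ (Fin n)`. -/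
abbrev QuadForm (n : ℕ) : Type := ContinuousMultilinearMap ℝ (fun _ : Fin 4 => Euc n) ℝ

/-- `M` is an algebraic curvature tensor: antisymmetric in the first two arguments,
symmetric under interchange of the first and second pair, and satisfying the
first Bianchi identity. -/
def IsCurvatureTensorQ {n : ℕ} (M : QuadForm n) : Prop :=
  (∀ x y z w : Euc n, M ![x, y, z, w] = - M ![y, x, z, w]) ∧
  (∀ x y z w : Euc n, M ![x, y, z, w] = M ![z, w, x, y]) ∧
  (∀ x y z w : Euc n, M ![x, y, z, w] + M ![y, z, x, w] + M ![z, x, y, w] = 0)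

/-- Nonnegative isotropic curvature for a quadrilinear form. -/
def NonnegIsotropicQ {n : ℕ} (M : QuadForm n) : Prop :=
  ∀ v₁ v₂ v₃ v₄ : Euc n, Orthonormal ℝ ![v₁, v₂, v₃, v₄] →
    0 ≤ M ![v₁, v₃, v₁, v₃] + M ![v₁, v₄, v₁, v₄] + M ![v₂, v₃, v₂, v₃] + M ![v₂, v₄, v₂, v₄]
        - 2 * M ![v₁, v₂, v₃, v₄]

/-- `t ↦ R t` solves the Hamilton ODE `dR/dt = Q(R)` on `[0,T)`: each `R t` is an algebraic
curvature tensor, and the derivative of `R` at `t` (in the sense of `HasDerivAt`, in the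
space of quadrilinear forms) is the quadrilinear form whose components in any orthonormal
basis are `Q(R)_{ijkl} = ∑_{p,q} (R_{ijpq} R_{klpq} + 2 R_{ipkq} R_{jplq} - 2 R_{iplq} R_{jpkq})`. -/
def IsHamiltonODESolution {n : ℕ} (T : ℝ) (R : ℝ → QuadForm n) : Prop :=
  (∀ t ∈ Set.Ico (0 : ℝ) T, IsCurvatureTensorQ (R t)) ∧
  ∀ t ∈ Set.Ico (0 : ℝ) T, ∃ R' : QuadForm n, HasDerivAt R R' t ∧
    ∀ (b : OrthonormalBasis (Fin n) ℝ (Euc n)) (i j k l : Fin n),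
      R' ![b i, b j, b k, b l] =
        ∑ p : Fin n, ∑ q : Fin n,
          (R t ![b i, b j, b p, b q] * R t ![b k, b l, b p, b q]
            + 2 * R t ![b i, b p, b k, b q] * R t ![b j, b p, b l, b q]
            - 2 * R t ![b i, b p, b l, b q] * R t ![b j, b p, b k, b q])

section isotropicCone

open Matrix

lemma nonneg_of_forall_pos_even (a b c d : ℝ)
    (h : ∀ t : ℝ, 0 ≤ t ^ 2 * (a + t ^ 2 * b + t ^ 4 * c + t ^ 6 * d)) : 0 ≤ a := by
  have hc : Filter.Tendsto (fun t : ℝ => a + t ^ 2 * b + t ^ 4 * c + t ^ 6 * d)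
      (nhdsWithin 0 (Set.Ioi 0)) (nhds a) := by
    have : Continuous (fun t : ℝ => a + t ^ 2 * b + t ^ 4 * c + t ^ 6 * d) := by fun_prop
    have h2 := (this.tendsto 0).mono_left (nhdsWithin_le_nhds (s := Set.Ioi 0))
    simpa using h2
  refine ge_of_tendsto hc ?_
  filter_upwards [self_mem_nhdsWithin] with t ht
  have ht' : (0:ℝ) < t := ht
  exact nonneg_of_mul_nonneg_right (h t) (by positivity)

lemma eq_zero_of_forall_nonneg (a : ℝ) (g : ℝ → ℝ) (hg : Continuous g)
    (h : ∀ t : ℝ, 0 ≤ t * (a + t * g t)) : a = 0 := by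
  have hc : Continuous (fun t : ℝ => a + t * g t) := by fun_prop
  apply le_antisymm
  · have h2 := (hc.tendsto 0).mono_left (nhdsWithin_le_nhds (s := Set.Iio 0))
    simp only [zero_mul, add_zero] at h2
    refine le_of_tendsto h2 ?_
    filter_upwards [self_mem_nhdsWithin] with t ht
    have ht' : t < 0 := ht
    have := h t
    by_contra hcon
    push Not at hcon
    nlinarith
  · have h2 := (hc.tendsto 0).mono_left (nhdsWithin_le_nhds (s := Set.Ioi 0))
    simp only [zero_mul, add_zero] at h2
    refine ge_of_tendsto h2 ?_
    filter_upwards [self_mem_nhdsWithin] with t ht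
    have ht' : (0:ℝ) < t := ht
    exact nonneg_of_mul_nonneg_right (h t) ht'

open ComplexConjugate in
lemma second_variation_nonneg (c : Fin 5 → Fin 5 → ℂ) (h00 : c 0 0 = 0)
    (h : ∀ s : ℂ, 0 ≤ (∑ j : Fin 5, ∑ k : Fin 5, s ^ (j : ℕ) * conj s ^ (k : ℕ) * c j k).re) :
    0 ≤ (c 1 1).re := by
  refine nonneg_of_forall_pos_even _ (c 2 2 + c 0 4 + c 4 0).re (c 3 3).re (c 4 4).re fun t => ?_
  have h1 := h t
  have h2 := h (-t)
  have h3 := h (Complex.I * t)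
  have h4 := h (-(Complex.I * t))
  have key := add_nonneg (add_nonneg h1 h2) (add_nonneg h3 h4)
  rw [← Complex.add_re, ← Complex.add_re, ← Complex.add_re] at key
  have e : (∑ j : Fin 5, ∑ k : Fin 5, (t:ℂ) ^ (j : ℕ) * conj (t:ℂ) ^ (k : ℕ) * c j k)
      + (∑ j : Fin 5, ∑ k : Fin 5, (-t:ℂ) ^ (j : ℕ) * conj (-t:ℂ) ^ (k : ℕ) * c j k)
      + ((∑ j : Fin 5, ∑ k : Fin 5,
          (Complex.I * t:ℂ) ^ (j : ℕ) * conj (Complex.I * t:ℂ) ^ (k : ℕ) * c j k)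
      + (∑ j : Fin 5, ∑ k : Fin 5,
          (-(Complex.I * t):ℂ) ^ (j : ℕ) * conj (-(Complex.I * t):ℂ) ^ (k : ℕ) * c j k))
      = ((4 * t ^ 2 : ℝ) : ℂ) * (c 1 1 + ((t ^ 2 : ℝ) : ℂ) * (c 2 2 + c 0 4 + c 4 0)
        + ((t ^ 4 : ℝ) : ℂ) * c 3 3 + ((t ^ 6 : ℝ) : ℂ) * c 4 4) := by
    simp only [Fin.sum_univ_five, map_neg, map_mul, Complex.conj_I, Complex.conj_ofReal]
    simp only [Fin.val_zero, Fin.val_one, Fin.val_two, show ((3 : Fin 5) : ℕ) = 3 from rfl,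
      show ((4 : Fin 5) : ℕ) = 4 from rfl, h00]
    push_cast
    ring_nf
    simp only [Complex.I_sq, Complex.I_pow_four,
      show Complex.I ^ 6 = -1 by
        rw [pow_succ, pow_succ, Complex.I_pow_four, one_mul, Complex.I_mul_I],
      show Complex.I ^ 8 = 1 by
        rw [show 8 = 4 * 2 by norm_num, pow_mul, Complex.I_pow_four, one_pow]]
    ring
  rw [e, Complex.re_ofReal_mul] at key
  simp only [Complex.add_re, Complex.re_ofReal_mul] at key ⊢
  linarith

open ComplexConjugate in
lemma first_variation_eq_zero (c : Fin 5 → Fin 5 → ℂ) (h00 : c 0 0 = 0)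
    (hc : c 1 0 = conj (c 0 1))
    (h : ∀ s : ℂ, 0 ≤ (∑ j : Fin 5, ∑ k : Fin 5, s ^ (j : ℕ) * conj s ^ (k : ℕ) * c j k).re) :
    c 0 1 = 0 := by
  have aux : ∀ u : ℂ, (u * c 1 0 + conj u * c 0 1).re = 0 := by
    intro u
    let g : ℝ → ℂ := fun t =>
      (∑ j : Fin 5, (conj u ^ 2 * c j 2 + t * conj u ^ 3 * c j 3 + t ^ 2 * conj u ^ 4 * c j 4)
        * (t * u) ^ (j : ℕ))
      + (u * conj u * c 1 1 + u ^ 2 * (c 2 0 + t * conj u * c 2 1)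
        + t * u ^ 3 * (c 3 0 + t * conj u * c 3 1) + t ^ 2 * u ^ 4 * (c 4 0 + t * conj u * c 4 1))
    refine eq_zero_of_forall_nonneg _ (fun t => (g t).re) ?_ fun t => ?_
    · refine Complex.continuous_re.comp ?_
      simp only [g]
      fun_prop
    · have h1 := h (t * u)
      have e : (∑ j : Fin 5, ∑ k : Fin 5, (t * u) ^ (j : ℕ) * conj (t * u) ^ (k : ℕ) * c j k)
          = (t : ℂ) * ((u * c 1 0 + conj u * c 0 1) + t * g t) := by
        simp only [g, Fin.sum_univ_five, map_mul, Complex.conj_ofReal]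
        simp only [Fin.val_zero, Fin.val_one, Fin.val_two, show ((3 : Fin 5) : ℕ) = 3 from rfl,
          show ((4 : Fin 5) : ℕ) = 4 from rfl, h00]
        ring
      rw [e, Complex.re_ofReal_mul, Complex.add_re, Complex.re_ofReal_mul] at h1
      exact h1
  have a1 := aux 1
  have a2 := aux Complex.I
  rw [hc] at a1 a2
  apply Complex.ext
  · simp at a1 ⊢
    linarith
  · simp at a2 ⊢
    linarith

/-- The components of an algebraic curvature tensor. -/
structure IsCurvatureArray {ι : Type*} (r : ι → ι → ι → ι → ℝ) : Prop where
  antisymm : ∀ i j k l, r j i k l = -r i j k l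
  pair : ∀ i j k l, r k l i j = r i j k l
  bianchi : ∀ i j k l, r i j k l + r j k i l + r k i j l = 0

section complexForm

variable {ι : Type*} [Fintype ι]

/-- The complex bilinear form on two-tensors whose components are `r`. -/
def tensorForm (r : ι → ι → ι → ι → ℝ) : (ι → ι → ℂ) →ₗ[ℂ] (ι → ι → ℂ) →ₗ[ℂ] ℂ :=
  LinearMap.mk₂ ℂ (fun P Q => ∑ i, ∑ j, ∑ k, ∑ l, (r i j k l : ℂ) * P i j * Q k l)
    (by intros; simp [mul_add, add_mul, Finset.sum_add_distrib])
    (by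
      intros
      simp only [Pi.smul_apply, smul_eq_mul, Finset.mul_sum]
      refine Finset.sum_congr rfl fun i _ => Finset.sum_congr rfl fun j _ =>
        Finset.sum_congr rfl fun k _ => Finset.sum_congr rfl fun l _ => by ring)
    (by intros; simp [mul_add, Finset.sum_add_distrib])
    (by
      intros
      simp only [Pi.smul_apply, smul_eq_mul, Finset.mul_sum]
      refine Finset.sum_congr rfl fun i _ => Finset.sum_congr rfl fun j _ =>
        Finset.sum_congr rfl fun k _ => Finset.sum_congr rfl fun l _ => by ring)

/-- The complex quadrilinear form whose components are `r`. -/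
def complexForm (r : ι → ι → ι → ι → ℝ) (x y z w : ι → ℂ) : ℂ :=
  tensorForm r (fun i j => x i * y j) (fun k l => z k * w l)

variable {r : ι → ι → ι → ι → ℝ}

lemma complexForm_apply (x y z w : ι → ℂ) : complexForm r x y z w =
    ∑ i, ∑ j, ∑ k, ∑ l, (r i j k l : ℂ) * (x i * y j) * (z k * w l) := rfl

lemma complexForm_add₁ (x x' y z w : ι → ℂ) :
    complexForm r (x + x') y z w = complexForm r x y z w + complexForm r x' y z w := by
  simp only [complexForm, ← LinearMap.add_apply, ← map_add]
  congr 2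
  ext i j
  simp only [Pi.add_apply]
  ring

lemma complexForm_smul₁ (c : ℂ) (x y z w : ι → ℂ) :
    complexForm r (c • x) y z w = c * complexForm r x y z w := by
  have h : (fun i j => (c • x) i * y j) = c • fun i j => x i * y j := by
    ext i j
    simp only [Pi.smul_apply, smul_eq_mul, mul_assoc]
  rw [complexForm, h, map_smul, LinearMap.smul_apply, smul_eq_mul, complexForm]

lemma complexForm_swap₁₂ (hr : IsCurvatureArray r) (x y z w : ι → ℂ) :
    complexForm r y x z w = -complexForm r x y z w := by
  rw [complexForm_apply, Finset.sum_comm, complexForm_apply]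
  simp only [← Finset.sum_neg_distrib]
  refine Finset.sum_congr rfl fun i _ => Finset.sum_congr rfl fun j _ =>
        Finset.sum_congr rfl fun k _ => Finset.sum_congr rfl fun l _ => ?_
  rw [hr.antisymm i j k l]
  push_cast
  ring

lemma complexForm_pair (hr : IsCurvatureArray r) (x y z w : ι → ℂ) :
    complexForm r z w x y = complexForm r x y z w := by
  rw [complexForm_apply, complexForm_apply]
  have e : ∀ f : ι → ι → ι → ι → ℂ,
      ∑ i, ∑ j, ∑ k, ∑ l, f i j k l = ∑ k, ∑ l, ∑ i, ∑ j, f i j k l := by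
    intro f
    simp only [← Fintype.sum_prod_type']
    refine Fintype.sum_equiv ⟨fun p => ⟨p.2.2.1, p.2.2.2, p.1, p.2.1⟩,
      fun p => ⟨p.2.2.1, p.2.2.2, p.1, p.2.1⟩, fun _ => rfl, fun _ => rfl⟩ _ _ fun _ => rfl
  rw [e]
  refine Finset.sum_congr rfl fun i _ => Finset.sum_congr rfl fun j _ =>
        Finset.sum_congr rfl fun k _ => Finset.sum_congr rfl fun l _ => ?_
  rw [hr.pair i j k l]
  ring

lemma complexForm_swap₃₄ (hr : IsCurvatureArray r) (x y z w : ι → ℂ) :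
    complexForm r x y w z = -complexForm r x y z w := by
  rw [complexForm_pair hr w z, complexForm_swap₁₂ hr, complexForm_pair hr]

lemma complexForm_bianchi (hr : IsCurvatureArray r) (x y z w : ι → ℂ) :
    complexForm r x y z w + complexForm r y z x w + complexForm r z x y w = 0 := by
  rw [complexForm_apply, complexForm_apply, complexForm_apply]
  have e1 : ∀ f : ι → ι → ι → ι → ℂ,
      ∑ i, ∑ j, ∑ k, ∑ l, f i j k l = ∑ k, ∑ i, ∑ j, ∑ l, f i j k l := by
    intro f
    simp only [← Fintype.sum_prod_type']
    exact Fintype.sum_equiv ⟨fun p => ⟨p.2.2.1, p.1, p.2.1, p.2.2.2⟩,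
      fun p => ⟨p.2.1, p.2.2.1, p.1, p.2.2.2⟩, fun _ => rfl, fun _ => rfl⟩ _ _ fun _ => rfl
  rw [e1 fun i j k l => (r i j k l : ℂ) * (y i * z j) * (x k * w l),
    e1 fun i j k l => (r i j k l : ℂ) * (z i * x j) * (y k * w l),
    e1 fun k i j l => (r i j k l : ℂ) * (z i * x j) * (y k * w l)]
  simp only [← Finset.sum_add_distrib]
  refine Finset.sum_eq_zero fun i _ => Finset.sum_eq_zero fun j _ =>
        Finset.sum_eq_zero fun k _ => Finset.sum_eq_zero fun l _ => ?_
  have h : (r i j k l : ℂ) + r j k i l + r k i j l = 0 := by exact_mod_cast hr.bianchi i j k l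
  linear_combination (x i * y j * z k * w l) * h

lemma complexForm_star (x y z w : ι → ℂ) :
    complexForm r (star x) (star y) (star z) (star w) = star (complexForm r x y z w) := by
  simp [complexForm_apply, star_sum]

lemma complexForm_add₂ (hr : IsCurvatureArray r) (x y y' z w : ι → ℂ) :
    complexForm r x (y + y') z w = complexForm r x y z w + complexForm r x y' z w := by
  rw [complexForm_swap₁₂ hr, complexForm_add₁, complexForm_swap₁₂ hr x, complexForm_swap₁₂ hr x]
  ring

lemma complexForm_smul₂ (hr : IsCurvatureArray r) (c : ℂ) (x y z w : ι → ℂ) :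
    complexForm r x (c • y) z w = c * complexForm r x y z w := by
  rw [complexForm_swap₁₂ hr, complexForm_smul₁, complexForm_swap₁₂ hr x]
  ring

lemma complexForm_add₃ (hr : IsCurvatureArray r) (x y z z' w : ι → ℂ) :
    complexForm r x y (z + z') w = complexForm r x y z w + complexForm r x y z' w := by
  rw [← complexForm_pair hr x y, complexForm_add₁, complexForm_pair hr x y,
    complexForm_pair hr x y]

lemma complexForm_smul₃ (hr : IsCurvatureArray r) (c : ℂ) (x y z w : ι → ℂ) :
    complexForm r x y (c • z) w = c * complexForm r x y z w := by
  rw [complexForm_pair hr, complexForm_smul₁, complexForm_pair hr]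

lemma complexForm_add₄ (hr : IsCurvatureArray r) (x y z w w' : ι → ℂ) :
    complexForm r x y z (w + w') = complexForm r x y z w + complexForm r x y z w' := by
  rw [← complexForm_pair hr x y, complexForm_add₂ hr, complexForm_pair hr x y,
    complexForm_pair hr x y]

lemma complexForm_smul₄ (hr : IsCurvatureArray r) (c : ℂ) (x y z w : ι → ℂ) :
    complexForm r x y z (c • w) = c * complexForm r x y z w := by
  rw [complexForm_pair hr, complexForm_smul₂ hr, complexForm_pair hr]

lemma complexForm_self₁₂ (hr : IsCurvatureArray r) (x z w : ι → ℂ) :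
    complexForm r x x z w = 0 := by
  have := complexForm_swap₁₂ hr x x z w
  linear_combination this / 2

lemma complexForm_self₃₄ (hr : IsCurvatureArray r) (x y z : ι → ℂ) :
    complexForm r x y z z = 0 := by
  have := complexForm_swap₃₄ hr x y z z
  linear_combination this / 2

/-- The isotropic curvature of the frame `x₁, x₂, x₃, x₄`. -/
def isotropicCurvature (r : ι → ι → ι → ι → ℝ) (x₁ x₂ x₃ x₄ : ι → ℂ) : ℂ :=
  complexForm r x₁ x₃ x₁ x₃ + complexForm r x₁ x₄ x₁ x₄ + complexForm r x₂ x₃ x₂ x₃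
    + complexForm r x₂ x₄ x₂ x₄ - 2 * complexForm r x₁ x₂ x₃ x₄

lemma complexForm_isotropic (hr : IsCurvatureArray r) (x y u v : ι → ℂ) :
    complexForm r (x + Complex.I • y) (u + Complex.I • v) (x + (-Complex.I) • y)
      (u + (-Complex.I) • v) = isotropicCurvature r x y u v := by
  simp only [complexForm_add₁, complexForm_add₂ hr, complexForm_add₃ hr, complexForm_add₄ hr,
    complexForm_smul₁, complexForm_smul₂ hr, complexForm_smul₃ hr, complexForm_smul₄ hr,
    isotropicCurvature]
  have p1 := complexForm_pair hr x u x v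
  have p2 := complexForm_pair hr x u y u
  have p3 := complexForm_pair hr x u y v
  have p4 := complexForm_pair hr x v y u
  have p5 := complexForm_pair hr x v y v
  have p6 := complexForm_pair hr y u y v
  have b := complexForm_bianchi hr x y u v
  have s1 := complexForm_swap₁₂ hr x u y v
  have hI := Complex.I_sq
  have hI3 : Complex.I ^ 3 = - Complex.I := Complex.I_pow_three
  have hI4 : Complex.I ^ 4 = 1 := Complex.I_pow_four
  ring_nf
  simp only [hI, hI3, hI4]
  rw [p1, p2, p3, p4, p5, p6]
  have p7 := complexForm_pair hr y u x v
  linear_combination 2 * b - 2 * s1 + 2 * p7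

/-- `r` has nonnegative isotropic curvature. -/
def NonnegIsotropicArray (r : ι → ι → ι → ι → ℝ) : Prop :=
  ∀ x y u v : ι → ℝ, x ⬝ᵥ x = 1 → y ⬝ᵥ y = 1 → u ⬝ᵥ u = 1 → v ⬝ᵥ v = 1 →
    x ⬝ᵥ y = 0 → x ⬝ᵥ u = 0 → x ⬝ᵥ v = 0 → y ⬝ᵥ u = 0 → y ⬝ᵥ v = 0 → u ⬝ᵥ v = 0 →
    0 ≤ (isotropicCurvature r (fun i => x i) (fun i => y i) (fun i => u i) (fun i => v i)).re

end complexForm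

section isotropic

variable {ι : Type*} [Fintype ι] {r : ι → ι → ι → ι → ℝ}

lemma dotProduct_re (z w : ι → ℂ) : (z ⬝ᵥ w).re =
    (fun i => (z i).re) ⬝ᵥ (fun i => (w i).re) - (fun i => (z i).im) ⬝ᵥ fun i => (w i).im := by
  simp [dotProduct, Complex.re_sum, Finset.sum_sub_distrib]

lemma dotProduct_im (z w : ι → ℂ) : (z ⬝ᵥ w).im =
    (fun i => (z i).re) ⬝ᵥ (fun i => (w i).im) + (fun i => (z i).im) ⬝ᵥ fun i => (w i).re := by
  simp [dotProduct, Complex.im_sum, Finset.sum_add_distrib]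

lemma complexForm_nonneg_of_orthogonal (hr : IsCurvatureArray r) (hN : NonnegIsotropicArray r)
    (z w : ι → ℂ) (hz : z ⬝ᵥ z = 0) (hw : w ⬝ᵥ w = 0) (hzw : z ⬝ᵥ w = 0)
    (hzw' : star z ⬝ᵥ w = 0) : 0 ≤ (complexForm r z w (star z) (star w)).re := by
  by_cases hz0 : z = 0
  · have : complexForm r z w (star z) (star w) = 0 := by
      rw [hz0, ← zero_smul ℂ (0 : ι → ℂ), complexForm_smul₁, zero_mul]
    rw [this, Complex.zero_re]
  by_cases hw0 : w = 0
  · have : complexForm r z w (star z) (star w) = 0 := by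
      rw [hw0, ← zero_smul ℂ (0 : ι → ℂ), complexForm_smul₂ hr, zero_mul]
    rw [this, Complex.zero_re]
  have e1 := dotProduct_re z z
  have e2 := dotProduct_im z z
  have e3 := dotProduct_re w w
  have e4 := dotProduct_im w w
  have e5 := dotProduct_re z w
  have e6 := dotProduct_im z w
  have e7 := dotProduct_re (star z) w
  have e8 := dotProduct_im (star z) w
  rw [hz, Complex.zero_re] at e1
  rw [hz, Complex.zero_im] at e2
  rw [hw, Complex.zero_re] at e3
  rw [hw, Complex.zero_im] at e4
  rw [hzw, Complex.zero_re] at e5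
  rw [hzw, Complex.zero_im] at e6
  rw [hzw', Complex.zero_re] at e7
  rw [hzw', Complex.zero_im] at e8
  have hs : (fun i => ((star z) i).im) = -fun i => (z i).im := by ext i; simp
  have hs' : (fun i => ((star z) i).re) = fun i => (z i).re := by ext i; simp
  rw [hs, hs', neg_dotProduct] at e7 e8
  set x : ι → ℝ := fun i => (z i).re with hx
  set y : ι → ℝ := fun i => (z i).im with hy
  set u : ι → ℝ := fun i => (w i).re with hu
  set v : ι → ℝ := fun i => (w i).im with hv
  rw [dotProduct_comm y x] at e2
  rw [dotProduct_comm v u] at e4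
  have hα : 0 < x ⬝ᵥ x := by
    have h0 : 0 ≤ x ⬝ᵥ x := Finset.sum_nonneg fun i _ => mul_self_nonneg _
    refine lt_of_le_of_ne h0 fun h => hz0 ?_
    have hx0 : x = 0 := dotProduct_self_eq_zero.mp h.symm
    have hy0 : y = 0 := dotProduct_self_eq_zero.mp (by linarith)
    ext i
    exact Complex.ext (congrFun hx0 i) (congrFun hy0 i)
  have hβ : 0 < u ⬝ᵥ u := by
    have h0 : 0 ≤ u ⬝ᵥ u := Finset.sum_nonneg fun i _ => mul_self_nonneg _
    refine lt_of_le_of_ne h0 fun h => hw0 ?_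
    have hx0 : u = 0 := dotProduct_self_eq_zero.mp h.symm
    have hy0 : v = 0 := dotProduct_self_eq_zero.mp (by linarith)
    ext i
    exact Complex.ext (congrFun hx0 i) (congrFun hy0 i)
  obtain ⟨a, ha0, ha⟩ : ∃ a : ℝ, 0 < a ∧ a * (a * (x ⬝ᵥ x)) = 1 := by
    refine ⟨(√(x ⬝ᵥ x))⁻¹, by positivity, ?_⟩
    have := Real.mul_self_sqrt hα.le
    have h' : √(x ⬝ᵥ x) ≠ 0 := by positivity
    field_simp
    nlinarith
  obtain ⟨b, hb0, hb⟩ : ∃ a : ℝ, 0 < a ∧ a * (a * (u ⬝ᵥ u)) = 1 := by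
    refine ⟨(√(u ⬝ᵥ u))⁻¹, by positivity, ?_⟩
    have := Real.mul_self_sqrt hβ.le
    have h' : √(u ⬝ᵥ u) ≠ 0 := by positivity
    field_simp
    nlinarith
  have key := hN (a • x) (a • y) (b • u) (b • v)
  simp only [smul_dotProduct, dotProduct_smul, smul_eq_mul] at key
  have hxy : x ⬝ᵥ y = 0 := by linarith
  have huv : u ⬝ᵥ v = 0 := by linarith
  have hxu : x ⬝ᵥ u = 0 := by linarith
  have hyv : y ⬝ᵥ v = 0 := by linarith
  have hxv : x ⬝ᵥ v = 0 := by linarith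
  have hyu : y ⬝ᵥ u = 0 := by linarith
  have hyy : y ⬝ᵥ y = x ⬝ᵥ x := by linarith
  have hvv : v ⬝ᵥ v = u ⬝ᵥ u := by linarith
  simp only [hxy, huv, hxu, hyv, hxv, hyu, hyy, hvv, ha, hb, mul_zero, forall_const] at key
  rw [← complexForm_isotropic hr] at key
  have q1 : (fun i => (((a • x) i : ℝ) : ℂ)) + Complex.I • (fun i => (((a • y) i : ℝ) : ℂ))
      = (a : ℂ) • z := by
    ext i
    apply Complex.ext <;> simp [x, y]
  have q2 : (fun i => (((b • u) i : ℝ) : ℂ)) + Complex.I • (fun i => (((b • v) i : ℝ) : ℂ))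
      = (b : ℂ) • w := by
    ext i
    apply Complex.ext <;> simp [u, v]
  have q3 : (fun i => (((a • x) i : ℝ) : ℂ)) + (-Complex.I) • (fun i => (((a • y) i : ℝ) : ℂ))
      = (a : ℂ) • star z := by
    ext i
    apply Complex.ext <;> simp [x, y]
  have q4 : (fun i => (((b • u) i : ℝ) : ℂ)) + (-Complex.I) • (fun i => (((b • v) i : ℝ) : ℂ))
      = (b : ℂ) • star w := by
    ext i
    apply Complex.ext <;> simp [u, v]
  rw [q1, q2, q3, q4, complexForm_smul₁, complexForm_smul₂ hr, complexForm_smul₃ hr,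
    complexForm_smul₄ hr, Complex.re_ofReal_mul, Complex.re_ofReal_mul, Complex.re_ofReal_mul,
    Complex.re_ofReal_mul] at key
  exact nonneg_of_mul_nonneg_right (nonneg_of_mul_nonneg_right (nonneg_of_mul_nonneg_right
    (nonneg_of_mul_nonneg_right key ha0) hb0) ha0) hb0

open ComplexOrder in
/-- Nonnegative isotropic curvature means nonnegativity on all totally isotropic complex planes. -/
lemma complexForm_nonneg_of_isotropic (hr : IsCurvatureArray r) (hN : NonnegIsotropicArray r)
    (z w : ι → ℂ) (hz : z ⬝ᵥ z = 0) (hw : w ⬝ᵥ w = 0) (hzw : z ⬝ᵥ w = 0) :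
    0 ≤ (complexForm r z w (star z) (star w)).re := by
  by_cases hz0 : star z ⬝ᵥ z = 0
  · have : z = 0 := dotProduct_star_self_eq_zero.mp hz0
    have : complexForm r z w (star z) (star w) = 0 := by
      rw [this, ← zero_smul ℂ (0 : ι → ℂ), complexForm_smul₁, zero_mul]
    rw [this, Complex.zero_re]
  set c : ℂ := -((star z ⬝ᵥ w) / (star z ⬝ᵥ z)) with hc
  have key := complexForm_nonneg_of_orthogonal hr hN z (w + c • z) hz
    (by simp [dotProduct_comm w z, hz, hw, hzw]) (by simp [hz, hzw])
    (by
      simp only [dotProduct_add, dotProduct_smul, smul_eq_mul, hc]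
      field_simp
      ring)
  rw [star_add, star_smul, complexForm_add₂ hr, complexForm_smul₂ hr, complexForm_self₁₂ hr,
    mul_zero, add_zero, complexForm_add₄ hr, complexForm_smul₄ hr, complexForm_self₃₄ hr,
    mul_zero, add_zero] at key
  exact key

/-- First and second variation at a null plane along a polynomial family of isotropic planes. -/
lemma complexForm_variation (hr : IsCurvatureArray r) (hN : NonnegIsotropicArray r)
    {z w : ι → ℂ} (h0 : complexForm r z w (star z) (star w) = 0) (a b a' b' : ι → ℂ)
    (hz : ∀ s : ℂ, (z + s • a + s ^ 2 • a') ⬝ᵥ (z + s • a + s ^ 2 • a') = 0)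
    (hw : ∀ s : ℂ, (w + s • b + s ^ 2 • b') ⬝ᵥ (w + s • b + s ^ 2 • b') = 0)
    (hzw : ∀ s : ℂ, (z + s • a + s ^ 2 • a') ⬝ᵥ (w + s • b + s ^ 2 • b') = 0) :
    complexForm r z w (star a) (star w) + complexForm r z w (star z) (star b) = 0 ∧
    0 ≤ (complexForm r a w (star a) (star w) + complexForm r a w (star z) (star b)
      + complexForm r z b (star a) (star w) + complexForm r z b (star z) (star b)).re := by
  let P : Fin 5 → ι → ι → ℂ := ![fun i j => z i * w j, fun i j => a i * w j + z i * b j,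
    fun i j => a' i * w j + a i * b j + z i * b' j, fun i j => a' i * b j + a i * b' j,
    fun i j => a' i * b' j]
  let c : Fin 5 → Fin 5 → ℂ := fun j k => tensorForm r (P j) (star (P k))
  have hpos : ∀ s : ℂ, 0 ≤ (∑ j : Fin 5, ∑ k : Fin 5,
      s ^ (j : ℕ) * (starRingEnd ℂ) s ^ (k : ℕ) * c j k).re := by
    intro s
    have h := complexForm_nonneg_of_isotropic hr hN _ _ (hz s) (hw s) (hzw s)
    have e1 : (fun i j => (z + s • a + s ^ 2 • a') i * (w + s • b + s ^ 2 • b') j)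
        = ∑ j : Fin 5, s ^ (j : ℕ) • P j := by
      ext i j
      simp [Fin.sum_univ_five, P]
      ring
    have e2 : (fun i j => (star (z + s • a + s ^ 2 • a')) i * (star (w + s • b + s ^ 2 • b')) j)
        = ∑ k : Fin 5, (starRingEnd ℂ) s ^ (k : ℕ) • star (P k) := by
      ext i j
      simp [Fin.sum_univ_five, P]
      ring
    rw [complexForm, e1, e2, map_sum (tensorForm r), LinearMap.sum_apply] at h
    simpa only [map_smul, LinearMap.smul_apply, map_sum, smul_eq_mul, Finset.mul_sum, mul_assoc,
      mul_left_comm, c] using h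
  have t1 : ∀ Q : ι → ι → ℂ, tensorForm r (P 1) Q
      = tensorForm r (fun i j => a i * w j) Q + tensorForm r (fun i j => z i * b j) Q := by
    intro Q
    rw [← LinearMap.add_apply, ← map_add]
    rfl
  have t2 : star (P 1) = (fun i j => (star a) i * (star w) j)
      + fun i j => (star z) i * (star b) j := by
    ext i j
    simp [P]
  have t0 : star (P 0) = fun i j => (star z) i * (star w) j := by
    ext i j
    simp [P]
  have h00 : c 0 0 = 0 := by
    simp only [c]
    rw [t0]
    exact h0
  have h01 : c 0 1 = complexForm r z w (star a) (star w) + complexForm r z w (star z) (star b) := by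
    simp only [c]
    rw [t2, map_add]
    rfl
  have h10 : c 1 0 = complexForm r a w (star z) (star w) + complexForm r z b (star z) (star w) := by
    simp only [c]
    rw [t1, t0]
    rfl
  have h11 : c 1 1 = complexForm r a w (star a) (star w) + complexForm r a w (star z) (star b)
      + complexForm r z b (star a) (star w) + complexForm r z b (star z) (star b) := by
    simp only [c]
    rw [t1, t2, map_add, map_add, ← add_assoc, add_right_comm]
    simp only [complexForm]
    ring
  have hherm : c 1 0 = (starRingEnd ℂ) (c 0 1) := by
    rw [h10, h01, starRingEnd_apply, star_add, ← complexForm_star, ← complexForm_star]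
    simp only [star_star]
    rw [complexForm_pair hr a w, complexForm_pair hr z b]
  refine ⟨?_, ?_⟩
  · rw [← h01]
    exact first_variation_eq_zero c h00 hherm hpos
  · rw [← h11]
    exact second_variation_nonneg c h00 hpos

end isotropic

open ComplexOrder in
lemma posSemidef_fromBlocks_of_re_nonneg {κ : Type*} [Fintype κ] {A B B' C : Matrix κ κ ℂ}
    (hA : A.IsHermitian) (hC : C.IsHermitian) (hB : Bᴴ = B')
    (hq : ∀ a b : κ → ℂ, 0 ≤ (star a ⬝ᵥ (A *ᵥ a) + star a ⬝ᵥ (B *ᵥ b) + star b ⬝ᵥ (B' *ᵥ a)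
      + star b ⬝ᵥ (C *ᵥ b)).re) : (fromBlocks A B B' C).PosSemidef := by
  have hH : (fromBlocks A B B' C).IsHermitian := IsHermitian.fromBlocks hA hB hC
  refine PosSemidef.of_dotProduct_mulVec_nonneg hH fun x => ?_
  have hreal := hH.im_star_dotProduct_mulVec_self x
  rw [Complex.nonneg_iff]
  refine ⟨?_, hreal.symm⟩
  have := hq (x ∘ Sum.inl) (x ∘ Sum.inr)
  rw [fromBlocks_mulVec, dotProduct, Fintype.sum_sum_type]
  simp only [Sum.elim_inl, Sum.elim_inr, Pi.star_apply]
  convert this using 2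
  simp only [dotProduct, Pi.add_apply, Pi.star_apply, Function.comp_apply, mul_add,
    Finset.sum_add_distrib]
  ring

open ComplexOrder in
/-- A block form of the Schur product theorem. -/
lemma sum_mul_sub_mul_re_nonneg {κ : Type*} [Fintype κ] {A B B' C : Matrix κ κ ℂ}
    (hA : A.IsHermitian) (hC : C.IsHermitian) (hB : Bᴴ = B')
    (hq : ∀ a b : κ → ℂ, 0 ≤ (star a ⬝ᵥ (A *ᵥ a) + star a ⬝ᵥ (B *ᵥ b) + star b ⬝ᵥ (B' *ᵥ a)
      + star b ⬝ᵥ (C *ᵥ b)).re) :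
    0 ≤ (∑ p, ∑ q, (A p q * C p q - B p q * B' p q)).re := by
  have hG := posSemidef_fromBlocks_of_re_nonneg hA hC hB hq
  have hH : (fromBlocks C (-B') (-B) A).PosSemidef := by
    refine posSemidef_fromBlocks_of_re_nonneg hC hA
      (by rw [conjTranspose_neg, ← hB, conjTranspose_conjTranspose]) fun a b => ?_
    have h := hq (-b) a
    simp only [star_neg, neg_dotProduct, dotProduct_neg, mulVec_neg, neg_neg, neg_mulVec] at h ⊢
    convert h using 2
    ring
  have key := (hG.hadamard hH).dotProduct_mulVec_nonneg (fun _ => 1)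
  rw [Complex.nonneg_iff] at key
  have k1 := key.1
  have e : star (fun _ => (1 : ℂ)) ⬝ᵥ
      ((fromBlocks A B B' C ⊙ fromBlocks C (-B') (-B) A) *ᵥ fun _ => (1 : ℂ))
      = ((2 : ℝ) : ℂ) * ∑ p, ∑ q, (A p q * C p q - B p q * B' p q) := by
    simp only [dotProduct, mulVec, Fintype.sum_sum_type, hadamard_apply, fromBlocks_apply₁₁,
      fromBlocks_apply₁₂, fromBlocks_apply₂₁, fromBlocks_apply₂₂, Pi.star_apply, star_one,
      one_mul, mul_one, Matrix.neg_apply, mul_neg, Finset.sum_neg_distrib, Finset.sum_add_distrib,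
      Finset.sum_sub_distrib]
    simp only [mul_comm]
    push_cast
    ring
  rw [e, Complex.re_ofReal_mul] at k1
  linarith

section standardFrame

variable (κ : Type*)

/-- The isotropic vector `e₁ + i e₂`. -/
def isoZ : Fin 4 ⊕ κ → ℂ := Sum.elim ![1, Complex.I, 0, 0] 0

/-- The isotropic vector `e₃ + i e₄`. -/
def isoW : Fin 4 ⊕ κ → ℂ := Sum.elim ![0, 0, 1, Complex.I] 0

variable {κ}

section standardBasis

variable [DecidableEq κ]

/-- The standard basis of the complexification. -/
abbrev stdE (p : Fin 4 ⊕ κ) : Fin 4 ⊕ κ → ℂ := Pi.single p 1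

lemma isoZ_eq : isoZ κ = stdE (Sum.inl 0) + Complex.I • stdE (Sum.inl 1) := by
  ext p
  rcases p with p | p
  · fin_cases p <;> simp [isoZ, stdE]
  · simp [isoZ, stdE]

lemma isoW_eq : isoW κ = stdE (Sum.inl 2) + Complex.I • stdE (Sum.inl 3) := by
  ext p
  rcases p with p | p
  · fin_cases p <;> simp [isoW, stdE]
  · simp [isoW, stdE]

lemma star_stdE (p : Fin 4 ⊕ κ) : star (stdE p) = stdE p := by
  ext q
  simp [stdE, Pi.single_apply, apply_ite]

lemma star_isoZ : star (isoZ κ) = stdE (Sum.inl 0) + (-Complex.I) • stdE (Sum.inl 1) := by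
  rw [isoZ_eq, star_add, star_smul, star_stdE, star_stdE]
  simp

lemma star_isoW : star (isoW κ) = stdE (Sum.inl 2) + (-Complex.I) • stdE (Sum.inl 3) := by
  rw [isoW_eq, star_add, star_smul, star_stdE, star_stdE]
  simp

end standardBasis

variable [Fintype κ] {r : Fin 4 ⊕ κ → Fin 4 ⊕ κ → Fin 4 ⊕ κ → Fin 4 ⊕ κ → ℝ}

lemma variation_normal (hr : IsCurvatureArray r) (hN : NonnegIsotropicArray r)
    (h0 : complexForm r (isoZ κ) (isoW κ) (star (isoZ κ)) (star (isoW κ)) = 0) (a b : κ → ℂ) :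
    let z := isoZ κ
    let w := isoW κ
    let a' : Fin 4 ⊕ κ → ℂ := Sum.elim 0 a
    let b' : Fin 4 ⊕ κ → ℂ := Sum.elim 0 b
    complexForm r z w (star a') (star w) + complexForm r z w (star z) (star b') = 0 ∧
    0 ≤ (complexForm r a' w (star a') (star w) + complexForm r a' w (star z) (star b')
      + complexForm r z b' (star a') (star w) + complexForm r z b' (star z) (star b')).re := by
  intro z w a' b'
  refine complexForm_variation hr hN h0 a' b'
    ((-(a ⬝ᵥ a) / 4) • star z + (-(a ⬝ᵥ b) / 4) • star w)
    ((-(a ⬝ᵥ b) / 4) • star z + (-(b ⬝ᵥ b) / 4) • star w) ?_ ?_ ?_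
  all_goals
    intro s
    simp [dotProduct, Fintype.sum_sum_type, Fin.sum_univ_four, z, w, a', b', isoZ, isoW]
  · have : ∑ x, s * a x * (s * a x) = s ^ 2 * ∑ x, a x * a x := by
      rw [Finset.mul_sum]; exact Finset.sum_congr rfl fun _ _ => by ring
    rw [this]
    ring_nf
    simp only [Complex.I_sq]
    ring
  · have : ∑ x, s * b x * (s * b x) = s ^ 2 * ∑ x, b x * b x := by
      rw [Finset.mul_sum]; exact Finset.sum_congr rfl fun _ _ => by ring
    rw [this]
    ring_nf
    simp only [Complex.I_sq]
    ring
  · have : ∑ x, s * a x * (s * b x) = s ^ 2 * ∑ x, a x * b x := by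
      rw [Finset.mul_sum]; exact Finset.sum_congr rfl fun _ _ => by ring
    rw [this]
    ring_nf
    simp only [Complex.I_sq]
    ring

lemma variation_tangent (hr : IsCurvatureArray r) (hN : NonnegIsotropicArray r)
    (h0 : complexForm r (isoZ κ) (isoW κ) (star (isoZ κ)) (star (isoW κ)) = 0) :
    complexForm r (isoZ κ) (isoW κ) (isoW κ) (star (isoW κ))
      + complexForm r (isoZ κ) (isoW κ) (isoZ κ) (star (isoZ κ)) = 0 := by
  have h := (complexForm_variation hr hN h0 (star (isoW κ)) (-star (isoZ κ)) 0 0 ?_ ?_ ?_).1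
  · rw [star_star, star_neg, star_star, ← neg_one_smul ℂ (isoZ κ), complexForm_smul₄ hr] at h
    linear_combination h + complexForm_swap₃₄ hr (isoZ κ) (isoW κ) (isoZ κ) (star (isoZ κ))
  all_goals
    intro s
    simp [dotProduct, Fintype.sum_sum_type, Fin.sum_univ_four, isoZ, isoW]
    try ring_nf
    try simp only [Complex.I_sq]
    try ring

variable [DecidableEq κ]

lemma sum_contract₂ (hr : IsCurvatureArray r) (x u t x' u' t' : Fin 4 ⊕ κ → ℂ) :
    ∑ p : Fin 4, complexForm r x (stdE (Sum.inl p)) u t * complexForm r x' (stdE (Sum.inl p)) u' t'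
    = (complexForm r x (isoZ κ) u t * complexForm r x' (star (isoZ κ)) u' t'
      + complexForm r x (star (isoZ κ)) u t * complexForm r x' (isoZ κ) u' t'
      + complexForm r x (isoW κ) u t * complexForm r x' (star (isoW κ)) u' t'
      + complexForm r x (star (isoW κ)) u t * complexForm r x' (isoW κ) u' t') / 2 := by
  rw [star_isoZ, star_isoW, isoZ_eq, isoW_eq, Fin.sum_univ_four]
  simp only [complexForm_add₂ hr, complexForm_smul₂ hr]
  ring_nf
  simp only [Complex.I_sq]
  ring

lemma sum_contract₄ (hr : IsCurvatureArray r) (x u t x' u' t' : Fin 4 ⊕ κ → ℂ) :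
    ∑ p : Fin 4, complexForm r x u t (stdE (Sum.inl p)) * complexForm r x' u' t' (stdE (Sum.inl p))
    = (complexForm r x u t (isoZ κ) * complexForm r x' u' t' (star (isoZ κ))
      + complexForm r x u t (star (isoZ κ)) * complexForm r x' u' t' (isoZ κ)
      + complexForm r x u t (isoW κ) * complexForm r x' u' t' (star (isoW κ))
      + complexForm r x u t (star (isoW κ)) * complexForm r x' u' t' (isoW κ)) / 2 := by
  have h := sum_contract₂ hr t x u t' x' u'
  simpa only [complexForm_pair hr x u, complexForm_pair hr x' u'] using h

end standardFrame

section standardFrame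
variable {κ : Type*} [Fintype κ] [DecidableEq κ]
  {r : Fin 4 ⊕ κ → Fin 4 ⊕ κ → Fin 4 ⊕ κ → Fin 4 ⊕ κ → ℝ}

lemma complexForm_null_normal₁ (hr : IsCurvatureArray r) (hN : NonnegIsotropicArray r)
    (h0 : complexForm r (isoZ κ) (isoW κ) (star (isoZ κ)) (star (isoW κ)) = 0) (q : κ) :
    complexForm r (isoZ κ) (isoW κ) (star (isoZ κ)) (stdE (Sum.inr q)) = 0 := by
  have h := (variation_normal hr hN h0 0 (Pi.single q 1)).1
  have e : (Sum.elim 0 (Pi.single q 1) : Fin 4 ⊕ κ → ℂ) = stdE (Sum.inr q) := by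
    ext p
    rcases p with p | p <;> simp [stdE, Pi.single_apply]
  have e' : (Sum.elim 0 0 : Fin 4 ⊕ κ → ℂ) = (0 : ℂ) • 0 := by
    ext p
    rcases p with p | p <;> simp
  simp only [e, e'] at h
  rwa [star_smul, star_zero, complexForm_smul₃ hr, zero_mul, zero_add, star_stdE] at h

lemma complexForm_null_normal₂ (hr : IsCurvatureArray r) (hN : NonnegIsotropicArray r)
    (h0 : complexForm r (isoZ κ) (isoW κ) (star (isoZ κ)) (star (isoW κ)) = 0) (q : κ) :
    complexForm r (isoZ κ) (isoW κ) (star (isoW κ)) (stdE (Sum.inr q)) = 0 := by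
  have h := (variation_normal hr hN h0 (Pi.single q 1) 0).1
  have e : (Sum.elim 0 (Pi.single q 1) : Fin 4 ⊕ κ → ℂ) = stdE (Sum.inr q) := by
    ext p
    rcases p with p | p <;> simp [stdE, Pi.single_apply]
  have e' : (Sum.elim 0 0 : Fin 4 ⊕ κ → ℂ) = (0 : ℂ) • 0 := by
    ext p
    rcases p with p | p <;> simp
  simp only [e, e'] at h
  rw [star_smul, star_zero, complexForm_smul₄ hr, zero_mul, add_zero, star_stdE] at h
  rw [complexForm_swap₃₄ hr, h, neg_zero]

lemma sum_normal_re_nonneg (hr : IsCurvatureArray r) (hN : NonnegIsotropicArray r)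
    (h0 : complexForm r (isoZ κ) (isoW κ) (star (isoZ κ)) (star (isoW κ)) = 0) :
    0 ≤ (∑ p : κ, ∑ q : κ,
      (complexForm r (isoZ κ) (stdE (Sum.inr p)) (star (isoZ κ)) (stdE (Sum.inr q))
        * complexForm r (isoW κ) (stdE (Sum.inr p)) (star (isoW κ)) (stdE (Sum.inr q))
      - complexForm r (isoZ κ) (stdE (Sum.inr p)) (star (isoW κ)) (stdE (Sum.inr q))
        * complexForm r (isoW κ) (stdE (Sum.inr p)) (star (isoZ κ)) (stdE (Sum.inr q)))).re := by
  have hstar : ∀ (x y : Fin 4 ⊕ κ → ℂ) (p q : κ),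
      star (complexForm r x (stdE (Sum.inr q)) (star y) (stdE (Sum.inr p)))
      = complexForm r y (stdE (Sum.inr p)) (star x) (stdE (Sum.inr q)) := by
    intro x y p q
    rw [← complexForm_star, star_stdE, star_stdE, star_star, complexForm_pair hr]
  have hexp : ∀ (x y : Fin 4 ⊕ κ → ℂ) (a b : κ → ℂ),
      star a ⬝ᵥ ((Matrix.of fun p q => complexForm r x (stdE (Sum.inr p)) y (stdE (Sum.inr q)))
        *ᵥ b) = complexForm r x (Sum.elim 0 (star a)) y (Sum.elim 0 b) := by
    intro x y a b
    have hsum : ∀ c : κ → ℂ, (Sum.elim 0 c : Fin 4 ⊕ κ → ℂ)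
        = ∑ p, c p • stdE (Sum.inr p) := by
      intro c
      ext p
      rcases p with p | p <;> simp [Finset.sum_apply, Pi.single_apply]
    have hlin₂ : ∀ u v, ∀ c : κ → ℂ, complexForm r x (Sum.elim 0 c) u v
        = ∑ p, c p * complexForm r x (stdE (Sum.inr p)) u v := by
      intro u v c
      let L : (Fin 4 ⊕ κ → ℂ) →ₗ[ℂ] ℂ :=
        { toFun := fun y => complexForm r x y u v
          map_add' := fun y y' => complexForm_add₂ hr x y y' u v
          map_smul' := fun c y => complexForm_smul₂ hr c x y u v }
      change L _ = ∑ p, c p * L _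
      simp only [hsum, map_sum, map_smul, smul_eq_mul]
    have hlin₄ : ∀ u v, ∀ c : κ → ℂ, complexForm r x u v (Sum.elim 0 c)
        = ∑ p, c p * complexForm r x u v (stdE (Sum.inr p)) := by
      intro u v c
      let L : (Fin 4 ⊕ κ → ℂ) →ₗ[ℂ] ℂ :=
        { toFun := fun y => complexForm r x u v y
          map_add' := fun y y' => complexForm_add₄ hr x u v y y'
          map_smul' := fun c y => complexForm_smul₄ hr c x u v y }
      change L _ = ∑ p, c p * L _
      simp only [hsum, map_sum, map_smul, smul_eq_mul]
    rw [hlin₂]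
    simp only [dotProduct, mulVec, Matrix.of_apply]
    refine Finset.sum_congr rfl fun p _ => ?_
    rw [hlin₄]
    congr 1
    exact Finset.sum_congr rfl fun q _ => mul_comm _ _
  refine sum_mul_sub_mul_re_nonneg
    (A := Matrix.of fun p q => complexForm r (isoZ κ) (stdE (Sum.inr p)) (star (isoZ κ))
      (stdE (Sum.inr q)))
    (B := Matrix.of fun p q => complexForm r (isoZ κ) (stdE (Sum.inr p)) (star (isoW κ))
      (stdE (Sum.inr q)))
    (B' := Matrix.of fun p q => complexForm r (isoW κ) (stdE (Sum.inr p)) (star (isoZ κ))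
      (stdE (Sum.inr q)))
    (C := Matrix.of fun p q => complexForm r (isoW κ) (stdE (Sum.inr p)) (star (isoW κ))
      (stdE (Sum.inr q))) ?_ ?_ ?_ fun a b => ?_
  · ext p q
    exact hstar _ _ _ _
  · ext p q
    exact hstar _ _ _ _
  · ext p q
    exact hstar _ _ _ _
  · rw [hexp, hexp, hexp, hexp]
    have h := (variation_normal hr hN h0 (-star b) (star a)).2
    have e1 : (Sum.elim 0 (-star b) : Fin 4 ⊕ κ → ℂ)
        = (-1 : ℂ) • Sum.elim (0 : Fin 4 → ℂ) (star b) := by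
      ext p
      rcases p with p | p <;> simp
    have e2 : ∀ c : κ → ℂ, star (Sum.elim 0 (star c) : Fin 4 ⊕ κ → ℂ)
        = Sum.elim (0 : Fin 4 → ℂ) c := by
      intro c
      ext p
      rcases p with p | p <;> simp
    simp only [e1, star_smul, e2, complexForm_smul₁, complexForm_smul₃ hr] at h
    convert h using 2
    have s1 := complexForm_swap₁₂ hr (isoW κ) (Sum.elim 0 (star b)) (star (isoZ κ)) (Sum.elim 0 a)
    have s2 := complexForm_swap₁₂ hr (isoW κ) (Sum.elim 0 (star b)) (Sum.elim 0 b) (star (isoW κ))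
    have s3 := complexForm_swap₃₄ hr (isoW κ) (Sum.elim 0 (star b)) (star (isoW κ)) (Sum.elim 0 b)
    have s4 := complexForm_swap₃₄ hr (isoZ κ) (Sum.elim 0 (star a)) (star (isoW κ)) (Sum.elim 0 b)
    rw [star_neg, star_one]
    linear_combination s1 - s2 + s3 + s4

lemma sum_full_re_nonneg (hr : IsCurvatureArray r) (hN : NonnegIsotropicArray r)
    (h0 : complexForm r (isoZ κ) (isoW κ) (star (isoZ κ)) (star (isoW κ)) = 0) :
    0 ≤ (∑ p, ∑ q,
      (complexForm r (isoZ κ) (stdE p) (star (isoZ κ)) (stdE q)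
        * complexForm r (isoW κ) (stdE p) (star (isoW κ)) (stdE q)
      - complexForm r (isoZ κ) (stdE p) (star (isoW κ)) (stdE q)
        * complexForm r (isoW κ) (stdE p) (star (isoZ κ)) (stdE q))).re := by
  set z := isoZ κ with hz
  set w := isoW κ with hw
  have f1 : ∀ q : κ, complexForm r z w (star z) (stdE (Sum.inr q)) = 0 :=
    complexForm_null_normal₁ hr hN h0
  have f3 : ∀ q : κ, complexForm r z w (star w) (stdE (Sum.inr q)) = 0 :=
    complexForm_null_normal₂ hr hN h0
  have f2 : ∀ q : κ, complexForm r w z (star z) (stdE (Sum.inr q)) = 0 := fun q => by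
    rw [complexForm_swap₁₂ hr, f1, neg_zero]
  have f4 : ∀ q : κ, complexForm r w z (star w) (stdE (Sum.inr q)) = 0 := fun q => by
    rw [complexForm_swap₁₂ hr, f3, neg_zero]
  have g1 : ∀ q : κ, complexForm r z (stdE (Sum.inr q)) (star z) (star w) = 0 := fun q => by
    have := congrArg star (f1 q)
    rwa [← complexForm_star, star_star, star_stdE, star_zero, complexForm_pair hr] at this
  have g3 : ∀ q : κ, complexForm r w (stdE (Sum.inr q)) (star z) (star w) = 0 := fun q => by
    have := congrArg star (f3 q)
    rwa [← complexForm_star, star_star, star_stdE, star_zero, complexForm_pair hr] at this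
  have g2 : ∀ q : κ, complexForm r z (stdE (Sum.inr q)) (star w) (star z) = 0 := fun q => by
    rw [complexForm_swap₃₄ hr, g1, neg_zero]
  have g4 : ∀ q : κ, complexForm r w (stdE (Sum.inr q)) (star w) (star z) = 0 := fun q => by
    rw [complexForm_swap₃₄ hr, g3, neg_zero]
  have k2 : complexForm r w z (star z) (star w) = 0 := by
    rw [complexForm_swap₁₂ hr, h0, neg_zero]
  have k3 : complexForm r z w (star w) (star z) = 0 := by
    rw [complexForm_swap₃₄ hr, h0, neg_zero]
  have k4 : complexForm r w z (star w) (star z) = 0 := by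
    rw [complexForm_swap₃₄ hr, k2, neg_zero]
  have h1 : ∑ p : Fin 4, ∑ q : κ,
      (complexForm r z (stdE (Sum.inl p)) (star z) (stdE (Sum.inr q))
        * complexForm r w (stdE (Sum.inl p)) (star w) (stdE (Sum.inr q))
      - complexForm r z (stdE (Sum.inl p)) (star w) (stdE (Sum.inr q))
        * complexForm r w (stdE (Sum.inl p)) (star z) (stdE (Sum.inr q))) = 0 := by
    rw [Finset.sum_comm]
    refine Finset.sum_eq_zero fun q _ => ?_
    rw [Finset.sum_sub_distrib, sum_contract₂ hr, sum_contract₂ hr]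
    simp only [← hz, ← hw, complexForm_self₁₂ hr, f1, f2, f3, f4]
    ring
  have h2 : ∑ p : κ, ∑ q : Fin 4,
      (complexForm r z (stdE (Sum.inr p)) (star z) (stdE (Sum.inl q))
        * complexForm r w (stdE (Sum.inr p)) (star w) (stdE (Sum.inl q))
      - complexForm r z (stdE (Sum.inr p)) (star w) (stdE (Sum.inl q))
        * complexForm r w (stdE (Sum.inr p)) (star z) (stdE (Sum.inl q))) = 0 := by
    refine Finset.sum_eq_zero fun q _ => ?_
    rw [Finset.sum_sub_distrib, sum_contract₄ hr, sum_contract₄ hr]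
    simp only [← hz, ← hw, complexForm_self₃₄ hr, g1, g2, g3, g4]
    ring
  have h3 : ∑ p : Fin 4, ∑ q : Fin 4,
      (complexForm r z (stdE (Sum.inl p)) (star z) (stdE (Sum.inl q))
        * complexForm r w (stdE (Sum.inl p)) (star w) (stdE (Sum.inl q))
      - complexForm r z (stdE (Sum.inl p)) (star w) (stdE (Sum.inl q))
        * complexForm r w (stdE (Sum.inl p)) (star z) (stdE (Sum.inl q))) = 0 := by
    simp only [Finset.sum_sub_distrib, sum_contract₄ hr, ← Finset.sum_div, Finset.sum_add_distrib,
      sum_contract₂ hr]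
    simp only [← hz, ← hw, complexForm_self₃₄ hr, complexForm_self₁₂ hr, h0, k2, k3, k4]
    have t := variation_tangent hr hN h0
    have t' := congrArg star t
    rw [star_add, ← complexForm_star, ← complexForm_star] at t'
    simp only [← hz, ← hw, star_star, star_zero] at t t'
    have e1 := complexForm_swap₃₄ hr z w z (star z)
    have e2 : complexForm r w (star w) (star w) (star z)
        = complexForm r (star z) (star w) (star w) w := by
      rw [complexForm_pair hr (star w) (star z), complexForm_swap₁₂ hr (star z),
        complexForm_swap₃₄ hr (star z) (star w) (star w), neg_neg]
    have e3 : complexForm r z (star z) (star z) (star w)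
        = -complexForm r (star z) (star w) (star z) z := by
      rw [complexForm_pair hr (star z) (star w), complexForm_swap₃₄ hr (star z) (star w) (star z)]
    have e4 : complexForm r w z (star w) w = complexForm r z w w (star w) := by
      rw [complexForm_swap₁₂ hr z, complexForm_swap₃₄ hr z w w, neg_neg]
    have e5 : complexForm r z (star z) (star w) (star z)
        = complexForm r (star z) (star w) (star z) z := by
      rw [complexForm_swap₃₄ hr z (star z) (star z), e3, neg_neg]
    have e6 := complexForm_swap₁₂ hr z w (star z) z
    have e7 := complexForm_swap₃₄ hr z w w (star w)
    have e8 : complexForm r w (star w) (star z) (star w)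
        = -complexForm r (star z) (star w) (star w) w := by
      rw [complexForm_swap₃₄ hr w (star w) (star w), e2]
    rw [e6, e1, e2, e3, e4, e5, e7, e8]
    linear_combination (-1 / 4) * (complexForm r (star z) (star w) (star w) w
      + complexForm r (star z) (star w) (star z) z) * t
  simp only [Fintype.sum_sum_type, Finset.sum_add_distrib]
  rw [h1, h2, h3, add_zero, zero_add, zero_add]
  exact sum_normal_re_nonneg hr hN h0

end standardFrame

section hamiltonQ

variable {ι : Type*} [Fintype ι] {r : ι → ι → ι → ι → ℝ}

/-- The components of the reaction term `Q(R)` of the Hamilton ODE. -/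
def hamiltonQ (r : ι → ι → ι → ι → ℝ) (i j k l : ι) : ℝ :=
  ∑ p, ∑ q, (r i j p q * r k l p q + 2 * r i p k q * r j p l q - 2 * r i p l q * r j p k q)

/-- The quadratic expression in terms of which `Q(R)` can be written. -/
def sharpSum (r : ι → ι → ι → ι → ℝ) (i j k l : ι) : ℝ :=
  ∑ p, ∑ q, r i p j q * r k p l q

lemma sharpSum_comm (i j k l : ι) : sharpSum r k l i j = sharpSum r i j k l :=
  Finset.sum_congr rfl fun _ _ => Finset.sum_congr rfl fun _ _ => mul_comm _ _

lemma sharpSum_swap (hr : IsCurvatureArray r) (i j k l : ι) :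
    sharpSum r j i l k = sharpSum r i j k l := by
  rw [sharpSum, Finset.sum_comm]
  refine Finset.sum_congr rfl fun p _ => Finset.sum_congr rfl fun q _ => ?_
  rw [hr.pair i p j q, hr.pair k p l q]

lemma sum_mul_eq_sharpSum (hr : IsCurvatureArray r) (i j k l : ι) :
    ∑ p, ∑ q, r i j p q * r k l p q = 2 * sharpSum r i j k l - 2 * sharpSum r i j l k := by
  have h : ∀ i j p q, r i j p q = r i p j q - r j p i q := fun i j p q => by
    linear_combination hr.bianchi i j p q - hr.antisymm i p j q
  have e : 2 * sharpSum r i j k l - 2 * sharpSum r i j l k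
      = sharpSum r i j k l - sharpSum r i j l k - sharpSum r j i k l + sharpSum r j i l k := by
    linear_combination -sharpSum_swap hr i j k l + sharpSum_swap hr i j l k
  rw [e]
  simp only [sharpSum, ← Finset.sum_sub_distrib, ← Finset.sum_add_distrib]
  refine Finset.sum_congr rfl fun p _ => Finset.sum_congr rfl fun q _ => ?_
  rw [h i j p q, h k l p q]
  ring

lemma hamiltonQ_eq (hr : IsCurvatureArray r) (i j k l : ι) :
    hamiltonQ r i j k l = 2 * sharpSum r i j k l - 2 * sharpSum r i j l k
      + 2 * sharpSum r i k j l - 2 * sharpSum r i l j k := by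
  rw [← sum_mul_eq_sharpSum hr]
  simp only [hamiltonQ, sharpSum, Finset.mul_sum, ← Finset.sum_sub_distrib,
    ← Finset.sum_add_distrib, mul_assoc]

end hamiltonQ

section standardFrame

variable {κ : Type*} [Fintype κ] [DecidableEq κ]
  {r : Fin 4 ⊕ κ → Fin 4 ⊕ κ → Fin 4 ⊕ κ → Fin 4 ⊕ κ → ℝ}

lemma complexForm_stdE (i j k l : Fin 4 ⊕ κ) :
    complexForm r (stdE i) (stdE j) (stdE k) (stdE l) = r i j k l := by
  rw [complexForm_apply, Finset.sum_eq_single i, Finset.sum_eq_single j, Finset.sum_eq_single k,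
    Finset.sum_eq_single l]
  · simp
  all_goals simp +contextual [Pi.single_apply]

lemma sum_full_re_eq (hr : IsCurvatureArray r) :
    (∑ p, ∑ q,
      (complexForm r (isoZ κ) (stdE p) (star (isoZ κ)) (stdE q)
        * complexForm r (isoW κ) (stdE p) (star (isoW κ)) (stdE q)
      - complexForm r (isoZ κ) (stdE p) (star (isoW κ)) (stdE q)
        * complexForm r (isoW κ) (stdE p) (star (isoZ κ)) (stdE q))).re
    = let T : Fin 4 → Fin 4 → Fin 4 → Fin 4 → ℝ := fun i j k l =>
        sharpSum r (Sum.inl i) (Sum.inl j) (Sum.inl k) (Sum.inl l)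
      T 0 0 2 2 + T 0 0 3 3 + T 1 1 2 2 + T 1 1 3 3 - T 1 0 3 2 + T 1 0 2 3 + T 0 1 3 2
        - T 0 1 2 3 - T 0 2 2 0 - T 0 2 3 1 - T 1 3 2 0 - T 1 3 3 1
        + T 1 2 3 0 - T 1 2 2 1 - T 0 3 3 0 + T 0 3 2 1 := by
  simp only [sharpSum, ← Finset.sum_sub_distrib, ← Finset.sum_add_distrib, Complex.re_sum]
  refine Finset.sum_congr rfl fun p _ => Finset.sum_congr rfl fun q _ => ?_
  rw [star_isoZ, star_isoW, isoZ_eq, isoW_eq]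
  simp only [complexForm_add₁, complexForm_smul₁, complexForm_add₃ hr, complexForm_smul₃ hr,
    complexForm_stdE]
  simp
  ring

/-- The algebraic heart of the matter: the reaction term points into the cone of curvature
tensors with nonnegative isotropic curvature at a frame whose isotropic curvature vanishes. -/
lemma hamiltonQ_isotropic_nonneg (hr : IsCurvatureArray r) (hN : NonnegIsotropicArray r)
    (h0 : complexForm r (isoZ κ) (isoW κ) (star (isoZ κ)) (star (isoW κ)) = 0) :
    let q : Fin 4 → Fin 4 → Fin 4 → Fin 4 → ℝ := fun i j k l =>
      hamiltonQ r (Sum.inl i) (Sum.inl j) (Sum.inl k) (Sum.inl l)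
    0 ≤ q 0 2 0 2 + q 0 3 0 3 + q 1 2 1 2 + q 1 3 1 3 - 2 * q 0 1 2 3 := by
  have hS := sum_full_re_nonneg hr hN h0
  rw [sum_full_re_eq hr] at hS
  have hsq : 0 ≤ ∑ p, ∑ q,
      ((r (Sum.inl 0) (Sum.inl 2) p q - r (Sum.inl 1) (Sum.inl 3) p q) ^ 2
      + (r (Sum.inl 0) (Sum.inl 3) p q + r (Sum.inl 1) (Sum.inl 2) p q) ^ 2) := by positivity
  have hexp : ∑ p, ∑ q,
      ((r (Sum.inl 0) (Sum.inl 2) p q - r (Sum.inl 1) (Sum.inl 3) p q) ^ 2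
      + (r (Sum.inl 0) (Sum.inl 3) p q + r (Sum.inl 1) (Sum.inl 2) p q) ^ 2)
      = let B : Fin 4 → Fin 4 → Fin 4 → Fin 4 → ℝ := fun i j k l =>
        ∑ p, ∑ q, r (Sum.inl i) (Sum.inl j) p q * r (Sum.inl k) (Sum.inl l) p q
      B 0 2 0 2 - B 0 2 1 3 - B 0 2 1 3 + B 1 3 1 3 + B 0 3 0 3 + B 0 3 1 2 + B 0 3 1 2
        + B 1 2 1 2 := by
    simp only [← Finset.sum_sub_distrib, ← Finset.sum_add_distrib]
    refine Finset.sum_congr rfl fun p _ => Finset.sum_congr rfl fun q _ => ?_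
    ring
  rw [hexp] at hsq
  simp only [sum_mul_eq_sharpSum hr] at hsq
  intro q
  simp only [q, hamiltonQ_eq hr]
  let e : Fin 4 → Fin 4 ⊕ κ := Sum.inl
  have e1 := sharpSum_swap hr (e 0) (e 1) (e 2) (e 3)
  have e2 := sharpSum_swap hr (e 0) (e 1) (e 3) (e 2)
  have e3 := sharpSum_swap hr (e 0) (e 2) (e 3) (e 1)
  have e4 := sharpSum_comm (r := r) (e 2) (e 0) (e 1) (e 3)
  have e5 := sharpSum_swap hr (e 0) (e 3) (e 2) (e 1)
  have e6 := sharpSum_comm (r := r) (e 3) (e 0) (e 1) (e 2)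
  simp only [e] at e1 e2 e3 e4 e5 e6
  linarith

end standardFrame

section perturbation

variable {ι : Type*} [DecidableEq ι] {r : ι → ι → ι → ι → ℝ}

/-- The components of the curvature tensor of the round sphere. -/
def sphereArray (i j k l : ι) : ℝ :=
  (if i = k then 1 else 0) * (if j = l then 1 else 0)
    - (if i = l then 1 else 0) * (if j = k then 1 else 0)

lemma abs_sphereArray_le (i j k l : ι) : |sphereArray i j k l| ≤ 1 := by
  unfold sphereArray
  split_ifs <;> norm_num

lemma isCurvatureArray_add_sphere (hr : IsCurvatureArray r) (δ : ℝ) :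
    IsCurvatureArray fun i j k l => r i j k l + δ * sphereArray i j k l where
  antisymm i j k l := by
    rw [hr.antisymm i j k l, sphereArray, sphereArray]
    ring
  pair i j k l := by
    rw [hr.pair i j k l, sphereArray, sphereArray]
    simp only [eq_comm (a := k), eq_comm (a := l)]
    ring
  bianchi i j k l := by
    simp only [sphereArray, eq_comm (a := k), eq_comm (a := j)  (b := i)]
    linear_combination hr.bianchi i j k l

variable [Fintype ι]

lemma complexForm_add_sphere (δ : ℝ) (x y z w : ι → ℂ) :
    complexForm (fun i j k l => r i j k l + δ * sphereArray i j k l) x y z w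
      = complexForm r x y z w + δ * ((x ⬝ᵥ z) * (y ⬝ᵥ w) - (x ⬝ᵥ w) * (y ⬝ᵥ z)) := by
  have h1 : (x ⬝ᵥ z) * (y ⬝ᵥ w) = ∑ i, ∑ j, ∑ k, ∑ l,
      ((if i = k then 1 else 0) * (if j = l then 1 else 0) : ℂ) * (x i * y j) * (z k * w l) := by
    simp [dotProduct, Finset.sum_mul_sum]
    refine Finset.sum_congr rfl fun i _ => Finset.sum_congr rfl fun j _ => by ring
  have h2 : (x ⬝ᵥ w) * (y ⬝ᵥ z) = ∑ i, ∑ j, ∑ k, ∑ l,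
      ((if i = l then 1 else 0) * (if j = k then 1 else 0) : ℂ) * (x i * y j) * (z k * w l) := by
    simp [dotProduct, Finset.sum_mul_sum]
    refine Finset.sum_congr rfl fun i _ => Finset.sum_congr rfl fun j _ => by ring
  rw [h1, h2, complexForm_apply, complexForm_apply]
  simp only [← Finset.sum_sub_distrib, ← Finset.sum_add_distrib, Finset.mul_sum]
  refine Finset.sum_congr rfl fun i _ => Finset.sum_congr rfl fun j _ =>
        Finset.sum_congr rfl fun k _ => Finset.sum_congr rfl fun l _ => ?_
  have e : ∀ (P : Prop) [Decidable P], (((if P then 1 else 0 : ℝ)) : ℂ) = if P then 1 else 0 := by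
    intro P _
    split_ifs <;> simp
  simp only [sphereArray, Complex.ofReal_add, Complex.ofReal_mul, Complex.ofReal_sub, e]
  ring

lemma abs_hamiltonQ_add_sphere_sub_le {K δ : ℝ} (hK : ∀ i j k l, |r i j k l| ≤ K) (h0 : 0 ≤ δ)
    (h1 : δ ≤ 1) (i j k l : ι) :
    |hamiltonQ (fun i j k l => r i j k l + δ * sphereArray i j k l) i j k l - hamiltonQ r i j k l|
      ≤ 5 * (Fintype.card ι) ^ 2 * (2 * K + 1) * δ := by
  have hb : ∀ a b s t : ℝ, |a| ≤ K → |b| ≤ K → |s| ≤ 1 → |t| ≤ 1 →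
      |(a + δ * s) * (b + δ * t) - a * b| ≤ (2 * K + 1) * δ := by
    intro a b s t ha hb hs ht
    have e : (a + δ * s) * (b + δ * t) - a * b = δ * (a * t + s * b + δ * (s * t)) := by ring
    rw [e, abs_mul, abs_of_nonneg h0, mul_comm]
    refine mul_le_mul_of_nonneg_right ?_ h0
    have hK0 : 0 ≤ K := (abs_nonneg a).trans ha
    have t1 : |a * t| ≤ K * 1 := by
      rw [abs_mul]; exact mul_le_mul ha ht (abs_nonneg _) hK0
    have t2 : |s * b| ≤ 1 * K := by
      rw [abs_mul]; exact mul_le_mul hs hb (abs_nonneg _) zero_le_one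
    have t3 : |δ * (s * t)| ≤ 1 * (1 * 1) := by
      rw [abs_mul, abs_mul, abs_of_nonneg h0]
      gcongr
    have := abs_add_three (a * t) (s * b) (δ * (s * t))
    linarith
  have hcard : 5 * (Fintype.card ι : ℝ) ^ 2 * (2 * K + 1) * δ
      = ∑ _p : ι, ∑ _q : ι, 5 * ((2 * K + 1) * δ) := by
    simp
    ring
  rw [hcard, hamiltonQ, hamiltonQ, ← Finset.sum_sub_distrib]
  refine (Finset.abs_sum_le_sum_abs _ _).trans (Finset.sum_le_sum fun p _ => ?_)
  rw [← Finset.sum_sub_distrib]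
  refine (Finset.abs_sum_le_sum_abs _ _).trans (Finset.sum_le_sum fun q _ => ?_)
  have a1 := abs_le.1 (hb _ _ _ _ (hK i j p q) (hK k l p q) (abs_sphereArray_le i j p q)
    (abs_sphereArray_le k l p q))
  have a2 := abs_le.1 (hb _ _ _ _ (hK i p k q) (hK j p l q) (abs_sphereArray_le i p k q)
    (abs_sphereArray_le j p l q))
  have a3 := abs_le.1 (hb _ _ _ _ (hK i p l q) (hK j p k q) (abs_sphereArray_le i p l q)
    (abs_sphereArray_le j p k q))
  rw [abs_le]
  constructor <;> linarith [a1.1, a1.2, a2.1, a2.2, a3.1, a3.2]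

end perturbation

section components

variable {n : ℕ} {ι : Type*}

/-- The isotropic curvature of a quadrilinear form at a four-frame. -/
def isotropicQ (M : QuadForm n) (v : Fin 4 → Euc n) : ℝ :=
  M ![v 0, v 2, v 0, v 2] + M ![v 0, v 3, v 0, v 3] + M ![v 1, v 2, v 1, v 2]
    + M ![v 1, v 3, v 1, v 3] - 2 * M ![v 0, v 1, v 2, v 3]

/-- The components of a quadrilinear form with respect to a family of vectors. -/
def componentArray (M : QuadForm n) (b : ι → Euc n) (i j k l : ι) : ℝ :=
  M ![b i, b j, b k, b l]

lemma isCurvatureArray_component {M : QuadForm n} (hM : IsCurvatureTensorQ M) (b : ι → Euc n) :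
    IsCurvatureArray (componentArray M b) where
  antisymm _ _ _ _ := hM.1 _ _ _ _
  pair _ _ _ _ := hM.2.1 _ _ _ _
  bianchi _ _ _ _ := hM.2.2 _ _ _ _

lemma quadForm_sum_smul₁ [Fintype ι] (M : QuadForm n) (c : ι → ℝ) (b : ι → Euc n)
    (y z w : Euc n) :
    M ![∑ i, c i • b i, y, z, w] = ∑ i, c i * M ![b i, y, z, w] := by
  have h := map_sum (M.toMultilinearMap.toLinearMap ![0, y, z, w] 0) (fun i => c i • b i)
    Finset.univ
  have e : ∀ x : Euc n, Function.update ![0, y, z, w] 0 x = ![x, y, z, w] := fun x =>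
    Fin.update_cons_zero _ _ _
  simp only [map_smul, MultilinearMap.toLinearMap_apply, smul_eq_mul, e] at h
  exact h

lemma complexForm_component [Fintype ι] {M : QuadForm n} (hM : IsCurvatureTensorQ M)
    (b : ι → Euc n) (x y z w : ι → ℝ) :
    complexForm (componentArray M b) (fun i => x i) (fun i => y i) (fun i => z i) (fun i => w i)
      = (M ![∑ i, x i • b i, ∑ i, y i • b i, ∑ i, z i • b i, ∑ i, w i • b i] : ℝ) := by
  have h1 := quadForm_sum_smul₁ M (b := b)
  have h2 : ∀ (c : ι → ℝ) (x z w : Euc n),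
      M ![x, ∑ i, c i • b i, z, w] = ∑ i, c i * M ![x, b i, z, w] := fun c x z w => by
    rw [hM.1, h1, ← Finset.sum_neg_distrib]
    refine Finset.sum_congr rfl fun i _ => ?_
    rw [hM.1 (b i) x]
    ring
  have h3 : ∀ (c : ι → ℝ) (x y w : Euc n),
      M ![x, y, ∑ i, c i • b i, w] = ∑ i, c i * M ![x, y, b i, w] := fun c x y w => by
    rw [hM.2.1, h1]
    exact Finset.sum_congr rfl fun i _ => by rw [hM.2.1 (b i)]
  have h4 : ∀ (c : ι → ℝ) (x y z : Euc n),
      M ![x, y, z, ∑ i, c i • b i] = ∑ i, c i * M ![x, y, z, b i] := fun c x y z => by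
    rw [hM.2.1, h2]
    exact Finset.sum_congr rfl fun i _ => by rw [hM.2.1 z]
  rw [complexForm_apply]
  simp only [h1, h2, h3, h4, Finset.mul_sum]
  push_cast
  refine Finset.sum_congr rfl fun i _ => Finset.sum_congr rfl fun j _ =>
        Finset.sum_congr rfl fun k _ => Finset.sum_congr rfl fun l _ => ?_
  rw [componentArray]
  ring

lemma isotropicCurvature_component [Fintype ι] {M : QuadForm n} (hM : IsCurvatureTensorQ M)
    (b : ι → Euc n) (x y z w : ι → ℝ) :
    isotropicCurvature (componentArray M b) (fun i => x i) (fun i => y i) (fun i => z i)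
      (fun i => w i) = (isotropicQ M
        ![∑ i, x i • b i, ∑ i, y i • b i, ∑ i, z i • b i, ∑ i, w i • b i] : ℝ) := by
  simp only [isotropicCurvature, complexForm_component hM, isotropicQ]
  simp

end components

section components

variable {n : ℕ}

lemma Orthonormal.exists_orthonormalBasis_sum {m : ℕ} {v : Fin 4 → Euc (4 + m)}
    (hv : Orthonormal ℝ v) :
    ∃ b : OrthonormalBasis (Fin 4 ⊕ Fin m) ℝ (Euc (4 + m)), ∀ i, b (Sum.inl i) = v i := by
  have hs : Orthonormal ℝ ((Set.range (Sum.inl : Fin 4 → Fin 4 ⊕ Fin m)).domRestrict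
      (Sum.elim v fun _ => (0 : Euc (4 + m)))) := by
    have e : (Set.range (Sum.inl : Fin 4 → Fin 4 ⊕ Fin m)).domRestrict
      (Sum.elim v fun _ => (0 : Euc (4 + m)))
      = v ∘ (Equiv.ofInjective (Sum.inl : Fin 4 → Fin 4 ⊕ Fin m) Sum.inl_injective).symm := by
      rw [Equiv.eq_comp_symm]
      rfl
    rw [e]
    exact hv.comp _ (Equiv.injective _)
  obtain ⟨b, hb⟩ := hs.exists_orthonormalBasis_extension_of_card_eq (by simp)
  exact ⟨b, fun i => hb _ ⟨i, rfl⟩⟩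

lemma nonnegIsotropicArray_add_sphere {ι : Type*} [Fintype ι] [DecidableEq ι] {M : QuadForm n}
    (hM : IsCurvatureTensorQ M) {δ : ℝ} (b : OrthonormalBasis ι ℝ (Euc n))
    (hpos : ∀ v : Fin 4 → Euc n, Orthonormal ℝ v → 0 ≤ isotropicQ M v + 4 * δ) :
    NonnegIsotropicArray fun i j k l => componentArray M b i j k l + δ * sphereArray i j k l := by
  intro x y u v hx hy hu hv hxy hxu hxv hyu hyv huv
  have hin : ∀ x y : ι → ℝ, inner ℝ (∑ i, x i • b i) (∑ i, y i • b i) = x ⬝ᵥ y := by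
    intro x y
    rw [b.orthonormal.inner_sum]
    rfl
  have ho : Orthonormal ℝ
      ![∑ i, x i • b i, ∑ i, y i • b i, ∑ i, u i • b i, ∑ i, v i • b i] := by
    rw [orthonormal_iff_ite]
    intro i j
    fin_cases i <;> fin_cases j <;>
      simp [-inner_self_eq_norm_sq_to_K, hin, hx, hy, hu, hv, hxy, hxu, hxv, hyu, hyv, huv,
        dotProduct_comm y x, dotProduct_comm u x, dotProduct_comm v x, dotProduct_comm u y, dotProduct_comm v y,
        dotProduct_comm v u]
  have hdot : ∀ x y : ι → ℝ, (fun i => (x i : ℂ)) ⬝ᵥ (fun i => (y i : ℂ)) = (x ⬝ᵥ y : ℝ) := by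
    intro x y
    simp [dotProduct]
  have e : isotropicCurvature
      (fun i j k l => componentArray M b i j k l + δ * sphereArray i j k l)
      (fun i => x i) (fun i => y i) (fun i => u i) (fun i => v i)
      = isotropicCurvature (componentArray M b) (fun i => x i) (fun i => y i) (fun i => u i)
        (fun i => v i) + 4 * δ := by
    simp only [isotropicCurvature, complexForm_add_sphere, hdot, hx, hy, hu, hv, hxu, hxv, hyu,
      hyv, dotProduct_comm u x, dotProduct_comm v x, dotProduct_comm u y, dotProduct_comm v y]
    push_cast
    ring
  rw [e, isotropicCurvature_component hM]
  have := hpos _ ho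
  simpa using this

/-- If the isotropic curvature is at least `-4 * δ`, with equality at the frame `v`, then the
reaction term has isotropic curvature at least `-O(δ)` at `v`. -/
lemma isotropicQ_deriv_ge (hn : 4 ≤ n) {M M' : QuadForm n} (hM : IsCurvatureTensorQ M)
    (hM' : ∀ (b : OrthonormalBasis (Fin n) ℝ (Euc n)) (i j k l : Fin n),
      M' ![b i, b j, b k, b l] = hamiltonQ (componentArray M b) i j k l)
    {K δ : ℝ} (hK : ‖M‖ ≤ K) (h0 : 0 ≤ δ) (h1 : δ ≤ 1)
    (hpos : ∀ v : Fin 4 → Euc n, Orthonormal ℝ v → 0 ≤ isotropicQ M v + 4 * δ)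
    {v : Fin 4 → Euc n} (hv : Orthonormal ℝ v) (heq : isotropicQ M v + 4 * δ = 0) :
    -(30 * (n : ℝ) ^ 2 * (2 * K + 1)) * δ ≤ isotropicQ M' v := by
  obtain ⟨m, rfl⟩ := Nat.exists_eq_add_of_le hn
  obtain ⟨b, hb⟩ := hv.exists_orthonormalBasis_sum
  set r := componentArray M b with hr_def
  have hr : IsCurvatureArray r := isCurvatureArray_component hM b
  have hr' := isCurvatureArray_add_sphere hr δ
  have hN := nonnegIsotropicArray_add_sphere hM b hpos
  have hcomp : ∀ i j k l, M' ![b i, b j, b k, b l] = hamiltonQ r i j k l := by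
    intro i j k l
    have h := hM' (b.reindex finSumFinEquiv) (finSumFinEquiv i) (finSumFinEquiv j)
      (finSumFinEquiv k) (finSumFinEquiv l)
    simp only [OrthonormalBasis.reindex_apply, Equiv.symm_apply_apply] at h
    rw [h, hamiltonQ, hamiltonQ, ← Equiv.sum_comp finSumFinEquiv]
    refine Finset.sum_congr rfl fun p _ => ?_
    rw [← Equiv.sum_comp finSumFinEquiv]
    refine Finset.sum_congr rfl fun q _ => ?_
    simp [componentArray, hr_def]
  have hbound : ∀ i j k l, |r i j k l| ≤ K := by
    intro i j k l
    refine le_trans ?_ hK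
    have h := M.le_opNorm ![b i, b j, b k, b l]
    change |M ![b i, b j, b k, b l]| ≤ ‖M‖
    simpa [Fin.prod_univ_four] using h
  have hzero : complexForm (fun i j k l => r i j k l + δ * sphereArray i j k l)
      (isoZ (Fin m)) (isoW (Fin m)) (star (isoZ (Fin m))) (star (isoW (Fin m))) = 0 := by
    rw [star_isoZ, star_isoW, isoZ_eq, isoW_eq, complexForm_isotropic hr', isotropicCurvature]
    simp only [complexForm_stdE]
    simp only [r, componentArray, hb]
    rw [isotropicQ] at heq
    norm_cast
    simp [sphereArray]
    linarith
  have hq := hamiltonQ_isotropic_nonneg hr' hN hzero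
  have hd := fun i j k l => (abs_le.1
    (abs_hamiltonQ_add_sphere_sub_le hbound h0 h1 (Sum.inl i) (Sum.inl j) (Sum.inl k)
      (Sum.inl l))).2
  have hd' := fun i j k l => (abs_le.1
    (abs_hamiltonQ_add_sphere_sub_le hbound h0 h1 (Sum.inl i) (Sum.inl j) (Sum.inl k)
      (Sum.inl l))).1
  simp only [Fintype.card_sum, Fintype.card_fin] at hd hd'
  simp only [isotropicQ, ← hb, hcomp]
  have a1 := hd 0 2 0 2
  have a2 := hd 0 3 0 3
  have a3 := hd 1 2 1 2
  have a4 := hd 1 3 1 3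
  have a5 := hd' 0 1 2 3
  simp only at hq
  linarith

end components

section maximumPrinciple

/-- A function that attains a minimum over a left half-neighbourhood cannot have positive
derivative. -/
lemma HasDerivAt.nonpos_of_forall_le_left {f : ℝ → ℝ} {f' a t : ℝ} (hf : HasDerivAt f f' t)
    (hat : a < t) (h : ∀ s ∈ Set.Ioo a t, f t ≤ f s) : f' ≤ 0 := by
  have hs := (hasDerivAt_iff_tendsto_slope.1 hf).mono_left
    (nhdsWithin_mono t (show Set.Iio t ⊆ {t}ᶜ from fun _ hs => ne_of_lt hs))
  refine le_of_tendsto hs ?_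
  filter_upwards [Ioo_mem_nhdsLT hat] with s hs
  rw [slope_def_field]
  exact div_nonpos_of_nonneg_of_nonpos (sub_nonneg.2 (h s hs)) (sub_nonpos.2 hs.2.le)

variable {n : ℕ}

lemma isCompact_setOf_orthonormal : IsCompact {v : Fin 4 → Euc n | Orthonormal ℝ v} := by
  refine (isCompact_closedBall (0 : Fin 4 → Euc n) 1).of_isClosed_subset ?_ fun v hv => ?_
  · simp only [orthonormal_iff_ite, Set.ofPred_forall]
    refine isClosed_iInter fun i => isClosed_iInter fun j => ?_
    exact isClosed_eq (by fun_prop) continuous_const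
  · rw [mem_closedBall_zero_iff, pi_norm_le_iff_of_nonneg zero_le_one]
    exact fun i => (hv.1 i).le

lemma continuousOn_isotropicQ {X : Type*} [TopologicalSpace X] {s : Set X} {R : X → QuadForm n}
    {v : X → Fin 4 → Euc n} (hR : ContinuousOn R s) (hv : ContinuousOn v s) :
    ContinuousOn (fun x => isotropicQ (R x) (v x)) s := by
  have h : ∀ i j k l : Fin 4,
      ContinuousOn (fun x => R x ![v x i, v x j, v x k, v x l]) s := by
    intro i j k l
    refine hR.eval ?_
    have := fun i => (continuous_apply i).comp_continuousOn hv
    rw [continuousOn_pi]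
    intro a
    fin_cases a
    exacts [this i, this j, this k, this l]
  unfold isotropicQ
  exact ((((h _ _ _ _).add (h _ _ _ _)).add (h _ _ _ _)).add (h _ _ _ _)).sub
    (continuousOn_const.mul (h _ _ _ _))

lemma HasDerivAt.isotropicQ {R : ℝ → QuadForm n} {R' : QuadForm n} {t : ℝ}
    (hR : HasDerivAt R R' t) (v : Fin 4 → Euc n) :
    HasDerivAt (fun s => isotropicQ (R s) v) (isotropicQ R' v) t := by
  have h : ∀ m : Fin 4 → Euc n, HasDerivAt (fun s => R s m) (R' m) t := fun m =>
    ((ContinuousMultilinearMap.apply ℝ (fun _ : Fin 4 => Euc n) ℝ m).hasFDerivAt.comp_hasDerivAt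
      t hR)
  unfold _root_.isotropicQ
  exact ((((h _).add (h _)).add (h _)).add (h _)).sub ((h _).const_mul 2)

lemma nonnegIsotropicQ_iff (M : QuadForm n) :
    NonnegIsotropicQ M ↔ ∀ v : Fin 4 → Euc n, Orthonormal ℝ v → 0 ≤ isotropicQ M v := by
  constructor
  · intro h v hv
    refine h (v 0) (v 1) (v 2) (v 3) ?_
    convert hv
    ext i : 1
    fin_cases i <;> rfl
  · intro h v₁ v₂ v₃ v₄ hv
    exact h _ hv

lemma IsHamiltonODESolution.isotropicQ_add_pos (hn : 4 ≤ n) {T : ℝ} {R : ℝ → QuadForm n}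
    (hODE : IsHamiltonODESolution T R) (h0 : NonnegIsotropicQ (R 0)) {t₁ : ℝ} (ht₁ : t₁ < T)
    {K : ℝ} (hK0 : 0 ≤ K) (hK : ∀ t ∈ Set.Icc 0 t₁, ‖R t‖ ≤ K)
    {η : ℝ} (hη : 0 < η) (hη1 : η ≤ 1) {t : ℝ} (ht : t ∈ Set.Icc 0 t₁)
    {v : Fin 4 → Euc n} (hv : Orthonormal ℝ v) :
    0 < isotropicQ (R t) v
      + 4 * (η * Real.exp ((30 * (n : ℝ) ^ 2 * (2 * K + 1)) * (t - t₁))) := by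
  set L := 30 * (n : ℝ) ^ 2 * (2 * K + 1) with hL
  have hn0 : (0 : ℝ) < n := by exact_mod_cast (by lia : 0 < n)
  have hL0 : 0 < L := by positivity
  set δ : ℝ → ℝ := fun t => η * Real.exp (L * (t - t₁)) with hδ
  have hδ0 : ∀ t, 0 < δ t := fun t => by positivity
  have hδ1 : ∀ t ∈ Set.Icc 0 t₁, δ t ≤ 1 := fun t ht => by
    have : Real.exp (L * (t - t₁)) ≤ 1 :=
      Real.exp_le_one_iff.2 (mul_nonpos_of_nonneg_of_nonpos hL0.le (sub_nonpos.2 ht.2))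
    exact mul_le_one₀ hη1 (Real.exp_pos _).le this
  have hδc : Continuous δ := by fun_prop
  have hRc : ContinuousOn R (Set.Icc 0 t₁) := fun s hs => by
    obtain ⟨R', hR', -⟩ := hODE.2 s ⟨hs.1, hs.2.trans_lt ht₁⟩
    exact hR'.continuousAt.continuousWithinAt
  by_contra hcon
  rw [not_lt] at hcon
  set D : Set (ℝ × (Fin 4 → Euc n)) := Set.Icc 0 t₁ ×ˢ {v | Orthonormal ℝ v} with hD
  have hDc : IsCompact D := isCompact_Icc.prod isCompact_setOf_orthonormal
  have hφ : ContinuousOn (fun x : ℝ × (Fin 4 → Euc n) => isotropicQ (R x.1) x.2 + 4 * δ x.1) D :=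
    (continuousOn_isotropicQ (hRc.comp continuousOn_fst fun x hx => hx.1) continuousOn_snd).add
      (by fun_prop)
  have hA : IsCompact (D ∩ (fun x : ℝ × (Fin 4 → Euc n) =>
      isotropicQ (R x.1) x.2 + 4 * δ x.1) ⁻¹' Set.Iic 0) :=
    hDc.of_isClosed_subset (hφ.preimage_isClosed_of_isClosed hDc.isClosed isClosed_Iic)
      Set.inter_subset_left
  obtain ⟨⟨t₀, u⟩, ⟨⟨ht₀, hu⟩, hle⟩, hmin⟩ := hA.exists_isMinOn ⟨(t, v), ⟨ht, hv⟩, hcon⟩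
    continuousOn_fst
  simp only [Set.mem_preimage, Set.mem_Iic, Set.mem_ofPred_eq] at hle hu ht₀
  have hpos : ∀ s ∈ Set.Ico 0 t₀, ∀ w : Fin 4 → Euc n, Orthonormal ℝ w →
      0 < isotropicQ (R s) w + 4 * δ s := by
    intro s hs w hw
    by_contra hc
    rw [not_lt] at hc
    have : t₀ ≤ s := isMinOn_iff.1 hmin (s, w) ⟨⟨⟨hs.1, hs.2.le.trans ht₀.2⟩, hw⟩, hc⟩
    exact absurd hs.2 this.not_gt
  have ht₀0 : 0 < t₀ := by
    refine lt_of_le_of_ne ht₀.1 fun h => ?_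
    rw [← h] at hle
    have h1 := (nonnegIsotropicQ_iff _).1 h0 u hu
    have h2 := hδ0 0
    linarith
  obtain ⟨R', hR', hQ⟩ := hODE.2 t₀ ⟨ht₀.1, ht₀.2.trans_lt ht₁⟩
  have hδ' : HasDerivAt δ (η * (Real.exp (L * (t₀ - t₁)) * (L * 1))) t₀ :=
    (((hasDerivAt_id t₀).sub_const t₁).const_mul L).exp.const_mul η
  have hder : ∀ w, HasDerivAt (fun s => isotropicQ (R s) w + 4 * δ s)
      (isotropicQ R' w + 4 * (η * (Real.exp (L * (t₀ - t₁)) * (L * 1)))) t₀ := fun w =>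
    (hR'.isotropicQ w).add (hδ'.const_mul 4)
  have hnonneg : ∀ w : Fin 4 → Euc n, Orthonormal ℝ w → 0 ≤ isotropicQ (R t₀) w + 4 * δ t₀ := by
    intro w hw
    refine ge_of_tendsto ((hder w).continuousAt.tendsto.mono_left
      (nhdsWithin_le_nhds (s := Set.Iio t₀))) ?_
    filter_upwards [Ioo_mem_nhdsLT ht₀0] with s hs
    exact (hpos s ⟨hs.1.le, hs.2⟩ w hw).le
  have hzero := le_antisymm hle (hnonneg u hu)
  have hge := isotropicQ_deriv_ge hn (hODE.1 t₀ ⟨ht₀.1, ht₀.2.trans_lt ht₁⟩) hQ (hK t₀ ht₀)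
    (hδ0 t₀).le (hδ1 t₀ ht₀) hnonneg hu hzero
  have hle' := (hder u).nonpos_of_forall_le_left ht₀0 fun s hs => by
    rw [hzero]
    exact (hpos s ⟨hs.1.le, hs.2⟩ u hu).le
  have hLδ : 0 < L * δ t₀ := mul_pos hL0 (hδ0 t₀)
  have e : η * (Real.exp (L * (t₀ - t₁)) * (L * 1)) = L * δ t₀ := by
    simp only [hδ]
    ring
  rw [e] at hle'
  linarith

end maximumPrinciple

end isotropicCone

/-- Proposition `pic.is.preserved.2`: nonnegative isotropic curvature is preserved by
the Hamilton ODE `dR/dt = Q(R)`. -/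
theorem stmt_2 {n : ℕ} (hn : 4 ≤ n) (T : ℝ) (R : ℝ → QuadForm n)
    (hODE : IsHamiltonODESolution T R)
    (h0 : NonnegIsotropicQ (R 0)) :
    ∀ t ∈ Set.Ico (0 : ℝ) T, NonnegIsotropicQ (R t) := by
  intro t ht
  rw [nonnegIsotropicQ_iff]
  intro v hv
  have hRc : ContinuousOn R (Set.Icc 0 t) := fun s hs => by
    obtain ⟨R', hR', -⟩ := hODE.2 s ⟨hs.1, hs.2.trans_lt ht.2⟩
    exact hR'.continuousAt.continuousWithinAt
  obtain ⟨K, hK⟩ := isCompact_Icc.exists_bound_of_continuousOn hRc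
  have hK0 : 0 ≤ K := (norm_nonneg _).trans (hK 0 ⟨le_rfl, ht.1⟩)
  by_contra hneg
  rw [not_le] at hneg
  have hη : 0 < min 1 (-isotropicQ (R t) v / 4) := lt_min one_pos (by linarith)
  have h := hODE.isotropicQ_add_pos hn h0 ht.2 hK0 hK hη (min_le_left _ _) ⟨ht.1, le_rfl⟩ hv
  rw [sub_self, mul_zero, Real.exp_zero, mul_one] at h
  linarith [min_le_right 1 (-isotropicQ (R t) v / 4)]
end
end

section
/- Let R be an algebraic curvature tensor on E with nonnegative isotropic curvature, and suppose the orthonormal four-frame {e_1,e_2,e_3,e_4} attains isotropic curvature zero. Then R_{1213} + R_{1242} + R_{3413} + R_{3442} = 0 and R_{1214} + R_{1223} + R_{3414} + R_{3423} = 0. -/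
open scoped BigOperators
open RealInnerProductSpace

noncomputable section

theorem orthonormal_four_iff {n : ℕ} {v₁ v₂ v₃ v₄ : Euc n} :
    Orthonormal ℝ ![v₁, v₂, v₃, v₄] ↔
      (⟪v₁, v₁⟫ = 1 ∧ ⟪v₂, v₂⟫ = 1 ∧ ⟪v₃, v₃⟫ = 1 ∧ ⟪v₄, v₄⟫ = 1) ∧
      ⟪v₁, v₂⟫ = 0 ∧ ⟪v₁, v₃⟫ = 0 ∧ ⟪v₁, v₄⟫ = 0 ∧ ⟪v₂, v₃⟫ = 0 ∧ ⟪v₂, v₄⟫ = 0 ∧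
        ⟪v₃, v₄⟫ = 0 := by
  rw [orthonormal_iff_ite]
  constructor
  · intro h
    exact ⟨⟨h 0 0, h 1 1, h 2 2, h 3 3⟩, h 0 1, h 0 2, h 0 3, h 1 2, h 1 3, h 2 3⟩
  · rintro ⟨⟨h₁, h₂, h₃, h₄⟩, h₁₂, h₁₃, h₁₄, h₂₃, h₂₄, h₃₄⟩ i j
    fin_cases i <;> fin_cases j <;>
      simp [h₁, h₂, h₃, h₄, h₁₂, h₁₃, h₁₄, h₂₃, h₂₄, h₃₄,
        real_inner_comm, -inner_self_eq_norm_sq_to_K]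

/-- Rotating the first and fourth vectors of an orthonormal four-frame. -/
theorem Orthonormal.rotate_first_fourth {n : ℕ} {v₁ v₂ v₃ v₄ : Euc n}
    (hv : Orthonormal ℝ ![v₁, v₂, v₃, v₄]) {c s : ℝ} (hcs : c ^ 2 + s ^ 2 = 1) :
    Orthonormal ℝ ![c • v₁ + s • v₄, v₂, v₃, c • v₄ - s • v₁] := by
  rw [orthonormal_four_iff] at hv ⊢
  obtain ⟨⟨h₁, h₂, h₃, h₄⟩, h₁₂, h₁₃, h₁₄, h₂₃, h₂₄, h₃₄⟩ := hv
  have h₂₁ := (real_inner_comm v₁ v₂).trans h₁₂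
  have h₃₁ := (real_inner_comm v₁ v₃).trans h₁₃
  have h₄₁ := (real_inner_comm v₁ v₄).trans h₁₄
  have h₄₂ := (real_inner_comm v₂ v₄).trans h₂₄
  have h₄₃ := (real_inner_comm v₃ v₄).trans h₃₄
  refine ⟨⟨?_, h₂, h₃, ?_⟩, ?_, ?_, ?_, h₂₃, ?_, ?_⟩ <;>
    simp only [inner_add_left, inner_add_right, inner_sub_left, inner_sub_right,
      real_inner_smul_left, real_inner_smul_right, *] <;>
    linarith

theorem eq_zero_of_forall_quadratic_nonneg {a b : ℝ} (h : ∀ t : ℝ, 0 ≤ a * t ^ 2 + b * t) :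
    b = 0 := by
  have hd := discrim_le_zero (a := a) (b := b) (c := 0) fun t => by
    simpa [pow_two] using h t
  have : b ^ 2 ≤ 0 := by simpa [discrim] using hd
  exact pow_eq_zero_iff two_ne_zero |>.1 (le_antisymm this (sq_nonneg b))

/-- The first-order condition coming from the rotation of the first and fourth vectors of a
four-frame with vanishing isotropic curvature. -/
theorem NonnegIsotropic.first_order {n : ℕ} {R : CurvMap n} (hR : IsCurvatureTensor R)
    (hnic : NonnegIsotropic (fun x y z w => R x y z w)) {v₁ v₂ v₃ v₄ : Euc n}
    (hv : Orthonormal ℝ ![v₁, v₂, v₃, v₄])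
    (h0 : R v₁ v₃ v₁ v₃ + R v₁ v₄ v₁ v₄ + R v₂ v₃ v₂ v₃ + R v₂ v₄ v₂ v₄
      - 2 * R v₁ v₂ v₃ v₄ = 0) :
    R v₁ v₂ v₁ v₃ + R v₁ v₂ v₄ v₂ + R v₃ v₄ v₁ v₃ + R v₃ v₄ v₄ v₂ = 0 := by
  obtain ⟨anti, pair, -⟩ := hR
  have anti' (x y z w : Euc n) : R x y z w = -R x y w z := by
    rw [pair, anti, pair w z]
  have diag (x z w : Euc n) : R x x z w = 0 := by linarith [anti x x z w]
  have diag' (x y z : Euc n) : R x y z z = 0 := by linarith [anti' x y z z]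
  set b := R v₁ v₂ v₁ v₃ + R v₁ v₂ v₄ v₂ + R v₃ v₄ v₁ v₃ + R v₃ v₄ v₄ v₂ with hb
  set a := R v₁ v₂ v₁ v₂ + R v₃ v₄ v₃ v₄ + 2 * R v₁ v₂ v₃ v₄
    - (R v₁ v₃ v₁ v₃ + R v₂ v₄ v₂ v₄ - 2 * R v₁ v₃ v₂ v₄) with ha
  have key (c s : ℝ) (hcs : c ^ 2 + s ^ 2 = 1) : 0 ≤ a * s ^ 2 + -2 * b * (c * s) := by
    have h := hnic _ _ _ _ (hv.rotate_first_fourth hcs)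
    simp only [map_add, map_sub, map_smul, LinearMap.add_apply, LinearMap.sub_apply,
      LinearMap.smul_apply, smul_eq_mul, diag, diag'] at h
    rw [ha, hb]
    simp only [anti v₂ v₁, anti v₄ v₁, anti v₄ v₂, anti v₄ v₃, anti' _ _ v₂ v₁,
      anti' _ _ v₃ v₁, anti' _ _ v₄ v₁, anti' _ _ v₄ v₂, anti' _ _ v₄ v₃, pair v₂ v₄ v₁ v₂,
      pair v₂ v₄ v₁ v₃, pair v₃ v₄ v₁ v₃, pair v₃ v₄ v₂ v₄] at h h0 ⊢
    linear_combination h + h0 + (R v₁ v₃ v₁ v₃ + R v₂ v₄ v₂ v₄ - 2 * R v₁ v₂ v₃ v₄ +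
      (c ^ 2 + s ^ 2 + 1) * R v₁ v₄ v₁ v₄) * hcs
  have : -2 * b = 0 := by
    refine eq_zero_of_forall_quadratic_nonneg (a := a) fun t => ?_
    have ht : 0 < 1 + t ^ 2 := by positivity
    have hr : √(1 + t ^ 2) ^ 2 = 1 + t ^ 2 := Real.sq_sqrt ht.le
    have h := key (1 / √(1 + t ^ 2)) (t / √(1 + t ^ 2)) (by
      rw [div_pow, div_pow, hr]; field_simp)
    have e : a * (t / √(1 + t ^ 2)) ^ 2 + -2 * b * (1 / √(1 + t ^ 2) * (t / √(1 + t ^ 2))) =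
        (a * t ^ 2 + -2 * b * t) / (1 + t ^ 2) := by
      rw [div_mul_div_comm, ← pow_two, div_pow, hr]; ring
    rw [e] at h
    simpa using (le_div_iff₀ ht).1 h
  linarith

/-- Lemma `first.order.conditions.1`: first-order conditions at a minimizing four-frame. -/
theorem stmt_9 {n : ℕ} (hn : 4 ≤ n) (R : CurvMap n) (hR : IsCurvatureTensor R)
    (b : OrthonormalBasis (Fin n) ℝ (Euc n))
    (hnic : NonnegIsotropic (fun x y z w => R x y z w)) :
    let e₁ : Euc n := b ⟨0, by omega⟩
    let e₂ : Euc n := b ⟨1, by omega⟩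
    let e₃ : Euc n := b ⟨2, by omega⟩
    let e₄ : Euc n := b ⟨3, by omega⟩
    R e₁ e₃ e₁ e₃ + R e₁ e₄ e₁ e₄ + R e₂ e₃ e₂ e₃ + R e₂ e₄ e₂ e₄ - 2 * R e₁ e₂ e₃ e₄ = 0 →
    (R e₁ e₂ e₁ e₃ + R e₁ e₂ e₄ e₂ + R e₃ e₄ e₁ e₃ + R e₃ e₄ e₄ e₂ = 0 ∧
     R e₁ e₂ e₁ e₄ + R e₁ e₂ e₂ e₃ + R e₃ e₄ e₁ e₄ + R e₃ e₄ e₂ e₃ = 0) := by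
  intro e₁ e₂ e₃ e₄ h0
  have hv : Orthonormal ℝ ![e₁, e₂, e₃, e₄] := by
    rw [orthonormal_four_iff]
    simp [e₁, e₂, e₃, e₄, b.inner_eq_ite, -inner_self_eq_norm_sq_to_K]
  have hw : Orthonormal ℝ ![e₁, e₂, e₄, -e₃] := by
    rw [orthonormal_four_iff] at hv ⊢
    obtain ⟨⟨h₁, h₂, h₃, h₄⟩, h₁₂, h₁₃, h₁₄, h₂₃, h₂₄, h₃₄⟩ := hv
    have h₄₃ := (real_inner_comm e₃ e₄).trans h₃₄
    simp only [inner_neg_left, inner_neg_right, neg_neg, neg_zero, and_self, *]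
  refine ⟨hnic.first_order hR hv h0, ?_⟩
  have anti := hR.1
  have pair := hR.2.1
  have anti' (x y z w : Euc n) : R x y z w = -R x y w z := by
    rw [pair, anti, pair w z]
  have h := hnic.first_order hR hw (by
    simp only [map_neg, LinearMap.neg_apply, neg_neg]
    linarith [anti' e₁ e₂ e₄ e₃])
  simp only [map_neg, LinearMap.neg_apply, neg_neg] at h
  linarith [anti' e₁ e₂ e₃ e₂, anti e₄ e₃ e₁ e₄, anti e₄ e₃ e₃ e₂, anti' e₃ e₄ e₃ e₂]
end
end
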